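/- Let Ω ⊆ ℝⁿ be open and bounded and let Φ : [0,∞) → [0,∞) be monotone nondecreasing, lower semicontinuous, and satisfy Φ(t) → ∞ as t → ∞. Fix an admissible pair (u_o, E_o) in Ω with E_Ω(u_o, E_o) < ∞. Then there exists a minimal pair (u,E) in Ω such that u = u_o a.e. outside Ω, the function u − u_o (extended by 0 outside Ω) has a square-integrable weak gradient on all of ℝⁿ, and E\Ω coincides with E_o\Ω up to a set of measure zero. -/

import Mathlib

open MeasureTheory Filter Set Metric Bornology
open scoped ENNReal Topology symmDiff

noncomputable section

abbrev Pt (n : ℕ) : Type := EuclideanSpace ℝ (Fin n)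

/-- The interaction functional `L(A,B) = ∫_A ∫_B |x-y|^{-(n+σ)} dy dx`. -/
def interL (n : ℕ) (σ : ℝ) (A B : Set (Pt n)) : ℝ≥0∞ :=
  ∫⁻ x in A, ∫⁻ y in B, ENNReal.ofReal (‖x - y‖ ^ (-((n : ℝ) + σ)))

/-- The fractional `σ`-perimeter of `E` in `D`. -/
def fracPer (n : ℕ) (σ : ℝ) (E D : Set (Pt n)) : ℝ≥0∞ :=
  interL n σ (E ∩ D) Eᶜ + interL n σ (Eᶜ ∩ D) (E ∩ Dᶜ)

/-- `u` (locally integrable) has weak gradient `G` on the open set `U`. -/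
def HasWeakGradOn (n : ℕ) (u : Pt n → ℝ) (G : Pt n → Pt n) (U : Set (Pt n)) : Prop :=
  LocallyIntegrableOn G U volume ∧
  ∀ (i : Fin n) (φ : Pt n → ℝ), ContDiff ℝ (⊤ : ℕ∞) φ → HasCompactSupport φ →
    tsupport φ ⊆ U →
    ∫ x, u x * fderiv ℝ φ x (EuclideanSpace.single i 1) = -∫ x, G x i * φ x

/-- The zero-extension (by `0` outside `Ω`) of `w` has a square-integrable weak
gradient on all of `ℝⁿ`. -/
def ZeroExtGradL2 (n : ℕ) (Ω : Set (Pt n)) (w : Pt n → ℝ) : Prop :=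
  ∃ H : Pt n → Pt n,
    HasWeakGradOn n (Ω.indicator w) H Set.univ ∧
    Integrable (fun x => ‖H x‖ ^ 2) volume

/-- An admissible pair `(u,E)` in `Ω`, with `G` a weak gradient of `u` on `Ω`. -/
structure AdmissiblePair (n : ℕ) (σ : ℝ) (Ω : Set (Pt n)) (u : Pt n → ℝ)
    (G : Pt n → Pt n) (E : Set (Pt n)) : Prop where
  locInt : LocallyIntegrable u volume
  weakGrad : HasWeakGradOn n u G Ω
  dirichletFin : IntegrableOn (fun x => ‖G x‖ ^ 2) Ω volume
  measE : MeasurableSet E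
  perFin : fracPer n σ E Ω ≠ ∞
  nonnegOnE : ∀ᵐ x ∂(volume : Measure (Pt n)), x ∈ E → 0 ≤ u x
  nonposOffE : ∀ᵐ x ∂(volume : Measure (Pt n)), x ∉ E → u x ≤ 0

/-- The energy functional `E_Ω(u,E)` (with `G` the weak gradient of `u` on `Ω`). -/
def energyF (n : ℕ) (σ : ℝ) (Φ : ℝ → ℝ) (Ω : Set (Pt n)) (G : Pt n → Pt n)
    (E : Set (Pt n)) : ℝ :=
  (∫ x in Ω, ‖G x‖ ^ 2) + Φ ((fracPer n σ E Ω).toReal)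

/-- `(u,E)`, with weak gradient `G`, minimizes the energy in `Ω` among admissible
competitors with the same exterior data. -/
def MinimizesIn (n : ℕ) (σ : ℝ) (Φ : ℝ → ℝ) (Ω : Set (Pt n)) (u : Pt n → ℝ)
    (G : Pt n → Pt n) (E : Set (Pt n)) : Prop :=
  AdmissiblePair n σ Ω u G E ∧
  ∀ (v : Pt n → ℝ) (Gv : Pt n → Pt n) (F : Set (Pt n)),
    AdmissiblePair n σ Ω v Gv F →
    (∀ᵐ x ∂(volume : Measure (Pt n)), x ∉ Ω → v x = u x) →
    ZeroExtGradL2 n Ω (fun x => v x - u x) →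
    volume ((F \ Ω) ∆ (E \ Ω)) = 0 →
    energyF n σ Φ Ω G E ≤ energyF n σ Φ Ω Gv F

/-- `(u,E)` is a minimal pair in `Ω`. -/
def IsMinimalPair (n : ℕ) (σ : ℝ) (Φ : ℝ → ℝ) (Ω : Set (Pt n)) (u : Pt n → ℝ)
    (E : Set (Pt n)) : Prop :=
  ∃ G : Pt n → Pt n, MinimizesIn n σ Φ Ω u G E

/-- `ũ(x,y) = xy`. -/
def tildeU : Pt 2 → ℝ := fun p => p 0 * p 1

/-- `Ẽ = {(x,y) : xy > 0}`. -/
def tildeE : Set (Pt 2) := {p : Pt 2 | 0 < p 0 * p 1}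

/-- `∇ũ(x,y) = (y,x)`. -/
def tildeG : Pt 2 → Pt 2 := fun p => (WithLp.equiv 2 (Fin 2 → ℝ)).symm ![p 1, p 0]

/-- The precise representative `û` of a locally integrable function. -/
def preciseRep (n : ℕ) (u : Pt n → ℝ) (x : Pt n) : ℝ :=
  limsup (fun ε : ℝ => (volume (ball x ε)).toReal⁻¹ * ∫ y in ball x ε, u y)
    (𝓝[>] (0 : ℝ))

/-- Membership in the set `𝒰₀`. -/
def memU0 (n : ℕ) (Ω : Set (Pt n)) (u : Pt n → ℝ) (p : Pt n) : Prop :=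
  p ∈ Ω ∧ ∃ xs : ℕ → Pt n, (∀ k, xs k ∈ Ω) ∧ Tendsto xs atTop (𝓝 p) ∧
    Tendsto (fun k => preciseRep n u (xs k)) atTop (𝓝 (0 : ℝ))

end

lemma lintegral_enorm_setIntegral_le {X : Type*} [MeasurableSpace X] {μ : Measure X}
    [SFinite μ] {k : ℝ → X → ℝ} {s : ℝ} {c : ℝ≥0∞}
    (hk : AEStronglyMeasurable (Function.uncurry k) ((volume.restrict (Ioc (0 : ℝ) s)).prod μ))
    (hc : ∀ t ∈ Ioc (0 : ℝ) s, ∫⁻ x, ‖k t x‖ₑ ∂μ ≤ c) :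
    ∫⁻ x, ‖∫ t in Ioc (0 : ℝ) s, k t x‖ₑ ∂μ ≤ c * ENNReal.ofReal s := by
  calc ∫⁻ x, ‖∫ t in Ioc (0 : ℝ) s, k t x‖ₑ ∂μ
      ≤ ∫⁻ x, (∫⁻ t in Ioc (0 : ℝ) s, ‖k t x‖ₑ) ∂μ :=
        lintegral_mono fun x => enorm_integral_le_lintegral_enorm _
    _ = ∫⁻ t in Ioc (0 : ℝ) s, ∫⁻ x, ‖k t x‖ₑ ∂μ := (lintegral_lintegral_swap hk.enorm).symm
    _ ≤ ∫⁻ t in Ioc (0 : ℝ) s, c := setLIntegral_mono measurable_const hc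
    _ = c * ENNReal.ofReal s := by simp

section Translation

variable {X : Type*} [NormedAddCommGroup X] [NormedSpace ℝ X] [FiniteDimensional ℝ X]
  [MeasurableSpace X] [BorelSpace X] {μ : Measure X} [μ.IsAddHaarMeasure]

/-- Translations of a continuous compactly supported function are continuous in `L¹`. -/
lemma tendsto_lintegral_translate_sub_of_hasCompactSupport {g : X → ℝ} (hg : Continuous g)
    (hc : HasCompactSupport g) :
    Tendsto (fun t : X => ∫⁻ x, ‖g (x + t) - g x‖ₑ ∂μ) (𝓝 0) (𝓝 0) := by
  obtain ⟨M, hM⟩ := hg.bounded_above_of_compact_support hc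
  have hM0 : 0 ≤ M := (norm_nonneg _).trans (hM 0)
  set K : Set X := Metric.cthickening 1 (tsupport g) with hK
  have hKc : IsCompact K := hc.isCompact.cthickening
  have key := tendsto_lintegral_filter_of_dominated_convergence (μ := μ) (l := 𝓝 (0 : X))
    (F := fun t x => ‖g (x + t) - g x‖ₑ) (f := fun _ => 0)
    (K.indicator fun _ => ENNReal.ofReal (2 * M)) ?_ ?_ ?_ ?_
  · simpa using key
  · exact Eventually.of_forall fun t => by fun_prop
  · filter_upwards [Metric.ball_mem_nhds (0 : X) one_pos] with t ht
    refine Eventually.of_forall fun x => ?_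
    by_cases hx : x ∈ K
    · rw [indicator_of_mem hx, ← ofReal_norm]
      refine ENNReal.ofReal_le_ofReal ((norm_sub_le _ _).trans ?_)
      linarith [hM x, hM (x + t)]
    · have h1 : g x = 0 := by
        by_contra h
        exact hx (Metric.self_subset_cthickening _ (subset_tsupport g h))
      have h2 : g (x + t) = 0 := by
        by_contra h
        refine hx (Metric.mem_cthickening_of_dist_le x (x + t) 1 _ (subset_tsupport g h) ?_)
        simpa using (mem_ball_zero_iff.1 ht).le
      simp [h1, h2]
  · rw [lintegral_indicator hKc.measurableSet]
    rw [setLIntegral_const]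
    exact ENNReal.mul_ne_top ENNReal.ofReal_ne_top (hKc.measure_lt_top (μ := μ)).ne
  · refine Eventually.of_forall fun x => ?_
    have : Continuous fun t : X => ‖g (x + t) - g x‖ₑ := by fun_prop
    simpa using this.tendsto 0

/-- Translations of an integrable function are continuous in `L¹`. -/
lemma tendsto_lintegral_translate_sub {f : X → ℝ} (hf : Integrable f μ) :
    Tendsto (fun t : X => ∫⁻ x, ‖f (x + t) - f x‖ₑ ∂μ) (𝓝 0) (𝓝 0) := by
  rw [ENNReal.tendsto_nhds_zero]
  intro ε hε
  have hε3 : ε / 3 ≠ 0 := by simpa using hε.ne'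
  obtain ⟨g, hgc, hfg, hg, hgi⟩ := hf.exists_hasCompactSupport_lintegral_sub_le hε3
  have hmid := ENNReal.tendsto_nhds_zero.1
    (tendsto_lintegral_translate_sub_of_hasCompactSupport (μ := μ) hg hgc) (ε / 3)
    (pos_iff_ne_zero.2 hε3)
  filter_upwards [hmid] with t ht
  have hsub : AEMeasurable (fun x => ‖f x - g x‖ₑ) μ :=
    (hf.aestronglyMeasurable.sub hgi.aestronglyMeasurable).enorm
  have htr : ∫⁻ x, ‖f (x + t) - g (x + t)‖ₑ ∂μ = ∫⁻ x, ‖f x - g x‖ₑ ∂μ :=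
    lintegral_add_right_eq_self (fun x => ‖f x - g x‖ₑ) t
  have hpt : ∀ x, ‖f (x + t) - f x‖ₑ ≤
      ‖g (x + t) - g x‖ₑ + ‖f (x + t) - g (x + t)‖ₑ + ‖f x - g x‖ₑ := by
    intro x
    have : f (x + t) - f x =
        (g (x + t) - g x) + (f (x + t) - g (x + t)) - (f x - g x) := by ring
    rw [this]
    exact (enorm_sub_le).trans (add_le_add_left (enorm_add_le _ _) _)
  calc ∫⁻ x, ‖f (x + t) - f x‖ₑ ∂μ
      ≤ ∫⁻ x, (‖g (x + t) - g x‖ₑ + ‖f (x + t) - g (x + t)‖ₑ + ‖f x - g x‖ₑ) ∂μ :=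
        lintegral_mono hpt
    _ = (∫⁻ x, ‖g (x + t) - g x‖ₑ ∂μ) + (∫⁻ x, ‖f (x + t) - g (x + t)‖ₑ ∂μ)
          + ∫⁻ x, ‖f x - g x‖ₑ ∂μ := by
        rw [lintegral_add_right' _ hsub, lintegral_add_left (by fun_prop)]
    _ ≤ ε / 3 + ε / 3 + ε / 3 := by rw [htr]; gcongr
    _ = ε := ENNReal.add_thirds ε

/-- The function `(t, x) ↦ h (x + t e)` is integrable on finite slabs. -/
lemma integrable_prod_translate_smul {h : X → ℝ} (hh : Integrable h μ) (e : X)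
    (ν : Measure ℝ) [IsFiniteMeasure ν] :
    Integrable (fun p : ℝ × X => h (p.2 + p.1 • e)) (ν.prod μ) := by
  have hmp : MeasurePreserving (fun p : ℝ × X => (p.1, p.2 + p.1 • e)) (ν.prod μ) (ν.prod μ) :=
    (MeasurePreserving.id ν).skew_product (g := fun t x => x + t • e) (by fun_prop)
      (Eventually.of_forall fun t => map_add_right_eq_self μ (t • e))
  exact hmp.integrable_comp_of_integrable (g := fun p : ℝ × X => h p.2) (hh.comp_snd ν)

/-- A function with integrable weak derivative `h` in the direction `e` satisfies the fundamental
theorem of calculus along almost every line parallel to `e`. -/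
lemma ae_translate_sub_eq_integral {w h : X → ℝ} (hw : Integrable w μ) (hh : Integrable h μ)
    {e : X} (hweak : ∀ φ : X → ℝ, ContDiff ℝ (⊤ : ℕ∞) φ → HasCompactSupport φ →
      ∫ x, w x * fderiv ℝ φ x e ∂μ = -∫ x, h x * φ x ∂μ) {s : ℝ} (hs : 0 ≤ s) :
    ∀ᵐ x ∂μ, w (x + s • e) - w x = ∫ t in Ioc (0 : ℝ) s, h (x + t • e) := by
  have hprod := integrable_prod_translate_smul hh e (volume.restrict (Ioc (0 : ℝ) s))
  have hI : Integrable (fun x => ∫ t in Ioc (0 : ℝ) s, h (x + t • e)) μ := hprod.integral_prod_right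
  have hwt : Integrable (fun x => w (x + s • e)) μ := hw.comp_add_right _
  refine ae_eq_of_integral_contDiff_smul_eq (hwt.sub hw).locallyIntegrable hI.locallyIntegrable ?_
  intro φ hφ hφc
  have hφ' : Continuous (fderiv ℝ φ) := hφ.continuous_fderiv (by simp)
  obtain ⟨M, hM⟩ := hφ.continuous.bounded_above_of_compact_support hφc
  obtain ⟨M', hM'⟩ := hφ'.bounded_above_of_compact_support (hφc.fderiv ℝ)
  have hM'e : ∀ y, ‖fderiv ℝ φ y e‖ ≤ M' * ‖e‖ := fun y =>
    (ContinuousLinearMap.le_opNorm _ _).trans (by gcongr; exact hM' y)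
  set F : ℝ → ℝ := fun t => ∫ x, w x * φ (x - t • e) ∂μ with hF
  set F' : ℝ → ℝ := fun t => ∫ x, w x * -(fderiv ℝ φ (x - t • e) e) ∂μ with hF'
  have hmeas : ∀ t : ℝ, AEStronglyMeasurable (fun x => w x * -(fderiv ℝ φ (x - t • e) e)) μ := by
    intro t
    refine hw.aestronglyMeasurable.mul (Continuous.aestronglyMeasurable ?_)
    fun_prop
  have hbound : ∀ (t : ℝ) x, ‖w x * -(fderiv ℝ φ (x - t • e) e)‖ ≤ ‖w x‖ * (M' * ‖e‖) := by
    intro t x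
    rw [norm_mul, norm_neg]
    gcongr
    exact hM'e _
  have hder : ∀ t, HasDerivAt F (F' t) t := by
    intro t
    refine (hasDerivAt_integral_of_dominated_loc_of_deriv_le (s := univ)
      (F' := fun t x => w x * -(fderiv ℝ φ (x - t • e) e))
      (bound := fun x => ‖w x‖ * (M' * ‖e‖)) univ_mem ?_ ?_ (hmeas t) ?_
      (hw.norm.mul_const _) ?_).2
    · refine Eventually.of_forall fun r => hw.aestronglyMeasurable.mul ?_
      have := hφ.continuous
      exact Continuous.aestronglyMeasurable (by fun_prop)
    · refine hw.mul_bdd (c := M) (Continuous.aestronglyMeasurable ?_)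
        (Eventually.of_forall fun x => hM _)
      have := hφ.continuous
      fun_prop
    · exact Eventually.of_forall fun x r _ => hbound r x
    · refine Eventually.of_forall fun x r _ => ?_
      have h1 : HasFDerivAt φ (fderiv ℝ φ (x - r • e)) (x - r • e) :=
        (hφ.differentiable (by simp) _).hasFDerivAt
      have h2 : HasDerivAt (fun r : ℝ => x - r • e) (-e) r := by
        simpa using ((hasDerivAt_id r).smul_const e).const_sub x
      have := (h1.comp_hasDerivAt r h2).const_mul (w x)
      simpa using this
  have hF'c : Continuous F' := by
    refine continuous_of_dominated hmeas (fun t => Eventually.of_forall (hbound t))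
      (hw.norm.mul_const _) (Eventually.of_forall fun x => ?_)
    fun_prop
  have hftc : ∫ t in (0 : ℝ)..s, F' t = F s - F 0 :=
    intervalIntegral.integral_eq_sub_of_hasDerivAt (fun t _ => hder t)
      (hF'c.intervalIntegrable _ _)
  have hF'eq : ∀ t, F' t = ∫ x, h (x + t • e) * φ x ∂μ := by
    intro t
    have hφt : ContDiff ℝ (⊤ : ℕ∞) fun x => φ (x - t • e) :=
      hφ.comp (contDiff_id.sub contDiff_const)
    have hφtc : HasCompactSupport fun x => φ (x - t • e) := by
      simpa [Function.comp_def, sub_eq_add_neg] using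
        hφc.comp_homeomorph (Homeomorph.addRight (-(t • e)))
    have h1 := hweak _ hφt hφtc
    have h2 : F' t = ∫ x, h x * φ (x - t • e) ∂μ := by
      rw [← neg_inj, ← h1, hF', ← integral_neg]
      simp [fderiv_comp_sub]
    rw [h2, ← integral_add_right_eq_self _ (t • e)]
    simp
  have hFs : F s = ∫ x, φ x * w (x + s • e) ∂μ := by
    rw [hF]
    simp only
    rw [← integral_add_right_eq_self _ (s • e)]
    simp [mul_comm]
  have hF0 : F 0 = ∫ x, φ x * w x ∂μ := by simp [hF, mul_comm]
  have hbdd : ∀ {k : X → ℝ}, Integrable k μ → Integrable (fun x => φ x * k x) μ := fun hk =>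
    hk.bdd_mul (c := M) hφ.continuous.aestronglyMeasurable (Eventually.of_forall hM)
  have hprodφ : Integrable (Function.uncurry fun (t : ℝ) (x : X) => h (x + t • e) * φ x)
      ((volume.restrict (Ioc (0 : ℝ) s)).prod μ) := by
    refine hprod.mul_bdd (c := M) ?_ (Eventually.of_forall fun p => hM p.2)
    have := hφ.continuous
    exact Continuous.aestronglyMeasurable (by fun_prop)
  calc ∫ x, φ x • (w (x + s • e) - w x) ∂μ = F s - F 0 := by
        rw [hFs, hF0, ← integral_sub (hbdd hwt) (hbdd hw)]
        simp [mul_sub]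
    _ = ∫ t in Ioc (0 : ℝ) s, ∫ x, h (x + t • e) * φ x ∂μ := by
        rw [← hftc, intervalIntegral.integral_of_le hs]
        simp_rw [hF'eq]
    _ = ∫ x, (∫ t in Ioc (0 : ℝ) s, h (x + t • e) * φ x) ∂μ := integral_integral_swap hprodφ
    _ = _ := by simp_rw [integral_mul_const, smul_eq_mul, mul_comm]

/-- `L¹` translation estimate. -/
lemma lintegral_translate_sub_le {w h : X → ℝ} (hw : Integrable w μ) (hh : Integrable h μ)
    {e : X} (hweak : ∀ φ : X → ℝ, ContDiff ℝ (⊤ : ℕ∞) φ → HasCompactSupport φ →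
      ∫ x, w x * fderiv ℝ φ x e ∂μ = -∫ x, h x * φ x ∂μ) {s : ℝ} (hs : 0 ≤ s) :
    ∫⁻ x, ‖w (x + s • e) - w x‖ₑ ∂μ ≤ (∫⁻ x, ‖h x‖ₑ ∂μ) * ENNReal.ofReal s := by
  have hprod := integrable_prod_translate_smul hh e (volume.restrict (Ioc (0 : ℝ) s))
  rw [lintegral_congr_ae ((ae_translate_sub_eq_integral hw hh hweak hs).mono
    fun x hx => congrArg _ hx)]
  exact lintegral_enorm_setIntegral_le (k := fun t x => h (x + t • e)) hprod.aestronglyMeasurable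
    fun t _ => (lintegral_add_right_eq_self (fun x => ‖h x‖ₑ) (t • e)).le

/-- `L¹` estimate for difference quotients. -/
lemma lintegral_translate_sub_sub_le {w h : X → ℝ} (hw : Integrable w μ) (hh : Integrable h μ)
    {e : X} (hweak : ∀ φ : X → ℝ, ContDiff ℝ (⊤ : ℕ∞) φ → HasCompactSupport φ →
      ∫ x, w x * fderiv ℝ φ x e ∂μ = -∫ x, h x * φ x ∂μ) {s : ℝ} (hs : 0 ≤ s) {c : ℝ≥0∞}
    (hc : ∀ t ∈ Ioc (0 : ℝ) s, ∫⁻ x, ‖h (x + t • e) - h x‖ₑ ∂μ ≤ c) :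
    ∫⁻ x, ‖w (x + s • e) - w x - s * h x‖ₑ ∂μ ≤ c * ENNReal.ofReal s := by
  have hprod := integrable_prod_translate_smul hh e (volume.restrict (Ioc (0 : ℝ) s))
  have hcongr : ∀ᵐ x ∂μ, ‖w (x + s • e) - w x - s * h x‖ₑ =
      ‖∫ t in Ioc (0 : ℝ) s, (h (x + t • e) - h x)‖ₑ := by
    filter_upwards [ae_translate_sub_eq_integral hw hh hweak hs, hprod.prod_left_ae] with x hx hxi
    rw [integral_sub hxi (integrable_const _), ← hx]
    simp [hs]
  rw [lintegral_congr_ae hcongr]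
  exact lintegral_enorm_setIntegral_le (k := fun t x => h (x + t • e) - h x)
    (hprod.aestronglyMeasurable.sub (hh.comp_snd _).aestronglyMeasurable) hc

/-- The weak derivative of a function vanishes a.e. on any measurable set where the function
vanishes. -/
lemma ae_eq_zero_of_weakDeriv {w h : X → ℝ} (hw : Integrable w μ) (hh : Integrable h μ)
    {e : X} (hweak : ∀ φ : X → ℝ, ContDiff ℝ (⊤ : ℕ∞) φ → HasCompactSupport φ →
      ∫ x, w x * fderiv ℝ φ x e ∂μ = -∫ x, h x * φ x ∂μ) {Z : Set X} (hZ : MeasurableSet Z)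
    (hwZ : ∀ x ∈ Z, w x = 0) :
    ∀ᵐ x ∂μ, x ∈ Z → h x = 0 := by
  set g := Z.indicator h with hg
  have hgi : Integrable g μ := hh.indicator hZ
  have hcont : Tendsto (fun t : ℝ => t • e) (𝓝 0) (𝓝 0) := by
    have : Continuous fun t : ℝ => t • e := by fun_prop
    simpa using this.tendsto 0
  have hε : ∀ ε : ℝ≥0∞, 0 < ε → ∫⁻ x, ‖g x‖ₑ ∂μ ≤ ε + ε := by
    intro ε hε
    have h1 := hcont.eventually
      (ENNReal.tendsto_nhds_zero.1 (tendsto_lintegral_translate_sub hh) ε hε)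
    have h2 := hcont.eventually
      (ENNReal.tendsto_nhds_zero.1 (tendsto_lintegral_translate_sub hgi) ε hε)
    obtain ⟨δ, hδ, hball⟩ := Metric.eventually_nhds_iff.1 (h1.and h2)
    set s := δ / 2 with hs
    have hs0 : 0 < s := by positivity
    have hD := lintegral_translate_sub_sub_le hw hh hweak hs0.le (c := ε) fun t ht => by
      refine (hball ?_).1
      rw [Real.dist_eq, sub_zero, abs_of_pos ht.1]
      linarith [ht.2]
    have hG : ∫⁻ x, ‖g (x + s • e) - g x‖ₑ ∂μ ≤ ε := by
      refine (hball ?_).2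
      rw [Real.dist_eq, sub_zero, abs_of_pos hs0]
      linarith
    have hpt : ∀ x, ENNReal.ofReal s * ‖g x‖ₑ ≤
        ‖w (x + s • e) - w x - s * h x‖ₑ + ENNReal.ofReal s * ‖g (x + s • e) - g x‖ₑ := by
      intro x
      by_cases hx : x ∈ Z
      · by_cases hx' : x + s • e ∈ Z
        · refine le_add_right (le_of_eq ?_)
          simp [hwZ _ hx, hwZ _ hx', hg, hx, enorm_mul, Real.enorm_of_nonneg hs0.le]
        · refine le_add_left (le_of_eq ?_)
          simp [hg, hx']
      · simp [hg, hx]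
    have hmeas : AEMeasurable (fun x => ENNReal.ofReal s * ‖g (x + s • e) - g x‖ₑ) μ :=
      ((hgi.comp_add_right _).aestronglyMeasurable.sub hgi.aestronglyMeasurable).enorm.const_mul _
    have hs' : ENNReal.ofReal s ≠ 0 := by simpa using hs0
    refine (ENNReal.mul_le_mul_iff_right hs' ENNReal.ofReal_ne_top).1 ?_
    calc ENNReal.ofReal s * ∫⁻ x, ‖g x‖ₑ ∂μ = ∫⁻ x, ENNReal.ofReal s * ‖g x‖ₑ ∂μ :=
          (lintegral_const_mul' _ _ ENNReal.ofReal_ne_top).symm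
      _ ≤ _ := lintegral_mono hpt
      _ = (∫⁻ x, ‖w (x + s • e) - w x - s * h x‖ₑ ∂μ) +
            ENNReal.ofReal s * ∫⁻ x, ‖g (x + s • e) - g x‖ₑ ∂μ := by
          rw [lintegral_add_right' _ hmeas, lintegral_const_mul' _ _ ENNReal.ofReal_ne_top]
      _ ≤ ε * ENNReal.ofReal s + ENNReal.ofReal s * ε := by gcongr
      _ = ENNReal.ofReal s * (ε + ε) := by ring
  have hzero : ∫⁻ x, ‖g x‖ₑ ∂μ = 0 := by
    refine nonpos_iff_eq_zero.1 (ENNReal.le_of_forall_pos_le_add fun ε hε' _ => ?_)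
    have := hε (ε / 2 : ℝ≥0∞) (ENNReal.half_pos (by simpa using hε'.ne'))
    rwa [ENNReal.add_halves, ← zero_add (ε : ℝ≥0∞)] at this
  rw [lintegral_eq_zero_iff' hgi.aestronglyMeasurable.enorm] at hzero
  filter_upwards [hzero] with x hx hxZ
  simpa [hg, hxZ] using hx

/-- Poincaré inequality in `L¹` for functions vanishing outside a ball. -/
lemma lintegral_enorm_le_of_weakDeriv {w h : X → ℝ} (hw : Integrable w μ) (hh : Integrable h μ)
    {e : X} (he : ‖e‖ = 1) (hweak : ∀ φ : X → ℝ, ContDiff ℝ (⊤ : ℕ∞) φ → HasCompactSupport φ →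
      ∫ x, w x * fderiv ℝ φ x e ∂μ = -∫ x, h x * φ x ∂μ) {R : ℝ} (hR : 0 ≤ R)
    (hwR : ∀ x ∉ ball (0 : X) R, w x = 0) :
    ∫⁻ x, ‖w x‖ₑ ∂μ ≤ (∫⁻ x, ‖h x‖ₑ ∂μ) * ENNReal.ofReal (2 * R) := by
  refine le_trans (lintegral_mono fun x => ?_)
    (lintegral_translate_sub_le hw hh hweak (s := 2 * R) (by positivity))
  by_cases hx : x ∈ ball (0 : X) R
  · have : w (x + (2 * R) • e) = 0 := by
      refine hwR _ fun hx' => ?_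
      rw [mem_ball_zero_iff] at hx hx'
      have h1 : ‖(2 * R) • e‖ = 2 * R := by
        rw [norm_smul, he, Real.norm_of_nonneg (by positivity), mul_one]
      have h2 := norm_sub_le (x + (2 * R) • e) x
      rw [add_sub_cancel_left, h1] at h2
      linarith
    simp [this]
  · simp [hwR x hx]

end Translation

section WeakGradient

variable {n : ℕ}

lemma integrable_mul_of_locallyIntegrableOn {f φ : Pt n → ℝ} {U : Set (Pt n)}
    (hf : LocallyIntegrableOn f U volume) (hφ : Continuous φ) (hφc : HasCompactSupport φ)
    (hφU : tsupport φ ⊆ U) : Integrable (fun x => f x * φ x) volume := by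
  have h1 : IntegrableOn f (tsupport φ) volume := hf.integrableOn_compact_subset hφU hφc
  obtain ⟨M, hM⟩ := hφ.bounded_above_of_compact_support hφc
  have h2 : IntegrableOn (fun x => f x * φ x) (tsupport φ) volume :=
    h1.mul_bdd (c := M) hφ.aestronglyMeasurable (Eventually.of_forall hM)
  refine (integrableOn_iff_integrable_of_support_subset fun x hx => ?_).1 h2
  exact subset_tsupport _ (right_ne_zero_of_mul hx)

lemma LocallyIntegrableOn.coord {G : Pt n → Pt n} {U : Set (Pt n)}
    (hG : LocallyIntegrableOn G U volume) (i : Fin n) :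
    LocallyIntegrableOn (fun x => G x i) U volume := fun x hx => by
  obtain ⟨s, hs, hi⟩ := hG x hx
  exact ⟨s, hs, (EuclideanSpace.proj i : Pt n →L[ℝ] ℝ).integrable_comp hi⟩

lemma integrable_mul_fderiv {u φ : Pt n → ℝ} (hu : LocallyIntegrable u volume)
    (hφ : ContDiff ℝ (⊤ : ℕ∞) φ) (hφc : HasCompactSupport φ) (e : Pt n) :
    Integrable (fun x => u x * fderiv ℝ φ x e) volume := by
  have hφ' : Continuous (fderiv ℝ φ) := hφ.continuous_fderiv (by simp)
  refine integrable_mul_of_locallyIntegrableOn (U := univ) (locallyIntegrableOn_univ.2 hu)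
    (by fun_prop) ?_ (subset_univ _)
  exact hφc.fderiv_apply ℝ e

lemma HasWeakGradOn.mono {u : Pt n → ℝ} {G : Pt n → Pt n} {U V : Set (Pt n)}
    (h : HasWeakGradOn n u G U) (hVU : V ⊆ U) : HasWeakGradOn n u G V :=
  ⟨h.1.mono_set hVU, fun i φ hφ hφc hφV => h.2 i φ hφ hφc (hφV.trans hVU)⟩

/-- The weak gradient on `U` only depends on the values of the function on `U`. -/
lemma HasWeakGradOn.congr {u v : Pt n → ℝ} {G : Pt n → Pt n} {U : Set (Pt n)}
    (h : HasWeakGradOn n u G U) (huv : ∀ᵐ x, x ∈ U → u x = v x) : HasWeakGradOn n v G U := by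
  refine ⟨h.1, fun i φ hφ hφc hφU => ?_⟩
  rw [← h.2 i φ hφ hφc hφU]
  refine integral_congr_ae ?_
  filter_upwards [huv] with x hx
  by_cases hxφ : x ∈ tsupport φ
  · rw [hx (hφU hxφ)]
  · have : fderiv ℝ φ x = 0 := by
      by_contra hne
      exact hxφ (support_fderiv_subset ℝ hne)
    simp [this]

lemma HasWeakGradOn.linearCombination {u v : Pt n → ℝ} {G K : Pt n → Pt n} {U : Set (Pt n)}
    (hu : LocallyIntegrable u volume) (hv : LocallyIntegrable v volume)
    (hG : HasWeakGradOn n u G U) (hK : HasWeakGradOn n v K U) (a b : ℝ) :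
    HasWeakGradOn n (fun x => a * u x + b * v x) (fun x => a • G x + b • K x) U := by
  refine ⟨(hG.1.smul a).add (hK.1.smul b), fun i φ hφ hφc hφU => ?_⟩
  set e : Pt n := EuclideanSpace.single i 1 with he
  have h1 := integrable_mul_fderiv hu hφ hφc e
  have h2 := integrable_mul_fderiv hv hφ hφc e
  have h3 := integrable_mul_of_locallyIntegrableOn (LocallyIntegrableOn.coord hG.1 i)
    hφ.continuous hφc hφU
  have h4 := integrable_mul_of_locallyIntegrableOn (LocallyIntegrableOn.coord hK.1 i)
    hφ.continuous hφc hφU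
  have e1 : ∀ x, (a * u x + b * v x) * fderiv ℝ φ x e =
      a * (u x * fderiv ℝ φ x e) + b * (v x * fderiv ℝ φ x e) := fun x => by ring
  have e2 : ∀ x, (a • G x + b • K x) i * φ x = a * (G x i * φ x) + b * (K x i * φ x) := fun x => by
    simp; ring
  simp_rw [e1, e2]
  rw [integral_add (h1.const_mul a) (h2.const_mul b), integral_add (h3.const_mul a)
    (h4.const_mul b), integral_const_mul, integral_const_mul, integral_const_mul,
    integral_const_mul, hG.2 i φ hφ hφc hφU, hK.2 i φ hφ hφc hφU]
  ring

/-- Weak gradients are unique up to null sets. -/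
lemma HasWeakGradOn.ae_eq {u : Pt n → ℝ} {G K : Pt n → Pt n} {U : Set (Pt n)} (hU : IsOpen U)
    (hG : HasWeakGradOn n u G U) (hK : HasWeakGradOn n u K U) :
    ∀ᵐ x, x ∈ U → G x = K x := by
  have : ∀ i : Fin n, ∀ᵐ x, x ∈ U → G x i - K x i = 0 := by
    intro i
    have hGi := LocallyIntegrableOn.coord hG.1 i
    have hKi := LocallyIntegrableOn.coord hK.1 i
    refine hU.ae_eq_zero_of_integral_contDiff_smul_eq_zero (hGi.sub hKi) ?_
    intro φ hφ hφc hφU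
    have h1 := integrable_mul_of_locallyIntegrableOn hGi hφ.continuous hφc hφU
    have h2 := integrable_mul_of_locallyIntegrableOn hKi hφ.continuous hφc hφU
    have h3 := hG.2 i φ hφ hφc hφU
    rw [hK.2 i φ hφ hφc hφU, neg_inj] at h3
    have e1 : ∀ x, φ x • (G x i - K x i) = G x i * φ x - K x i * φ x := fun x => by
      simp; ring
    simp_rw [e1]
    rw [integral_sub h1 h2, h3, sub_self]
  filter_upwards [ae_all_iff.2 this] with x hx hxU
  ext i
  exact sub_eq_zero.1 (hx i hxU)

/-- The weak gradient vanishes on an open set where the function does. -/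
lemma HasWeakGradOn.ae_eq_zero {u : Pt n → ℝ} {G : Pt n → Pt n} {U : Set (Pt n)} (hU : IsOpen U)
    (hG : HasWeakGradOn n u G U) (hu : ∀ x ∈ U, u x = 0) : ∀ᵐ x, x ∈ U → G x = 0 := by
  have h0 : HasWeakGradOn n u (fun _ => 0) U :=
    HasWeakGradOn.congr (u := fun _ => 0)
      ⟨(locallyIntegrable_zero (μ := volume)).locallyIntegrableOn _, by simp⟩
      (Eventually.of_forall fun x hx => (hu x hx).symm)
  exact hG.ae_eq hU h0

/-- Weak gradients pass to `L¹` limits. -/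
lemma HasWeakGradOn.of_tendsto {w : ℕ → Pt n → ℝ} {H : ℕ → Pt n → Pt n} {w' : Pt n → ℝ}
    {H' : Pt n → Pt n} (hw : ∀ k, Integrable (w k) volume) (hH : ∀ k, Integrable (H k) volume)
    (hwg : ∀ k, HasWeakGradOn n (w k) (H k) univ) (hw' : Integrable w' volume)
    (hH' : Integrable H' volume)
    (hlim : Tendsto (fun k => ∫⁻ x, ‖w k x - w' x‖ₑ) atTop (𝓝 0))
    (hlimH : Tendsto (fun k => ∫⁻ x, ‖H k x - H' x‖ₑ) atTop (𝓝 0)) :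
    HasWeakGradOn n w' H' univ := by
  refine ⟨hH'.locallyIntegrable.locallyIntegrableOn _, fun i φ hφ hφc hφU => ?_⟩
  set e : Pt n := EuclideanSpace.single i 1 with he
  have hφ' : Continuous (fderiv ℝ φ) := hφ.continuous_fderiv (by simp)
  have aux : ∀ (f : ℕ → Pt n → ℝ) (f' ψ : Pt n → ℝ), (∀ k, Integrable (f k) volume) →
      Integrable f' volume → Continuous ψ → HasCompactSupport ψ →
      Tendsto (fun k => ∫⁻ x, ‖f k x - f' x‖ₑ) atTop (𝓝 0) →
      Tendsto (fun k => ∫ x, f k x * ψ x) atTop (𝓝 (∫ x, f' x * ψ x)) := by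
    intro f f' ψ hf hf' hψ hψc hlim
    obtain ⟨M, hM⟩ := hψ.bounded_above_of_compact_support hψc
    have hb : ∀ {k : Pt n → ℝ}, Integrable k volume → Integrable (fun x => k x * ψ x) volume :=
      fun hk => hk.mul_bdd (c := M) hψ.aestronglyMeasurable (Eventually.of_forall hM)
    refine tendsto_integral_of_L1 _ (hb hf').aestronglyMeasurable
      (Eventually.of_forall fun k => hb (hf k)) ?_
    have h0 : Tendsto (fun k => (∫⁻ x, ‖f k x - f' x‖ₑ) * ENNReal.ofReal M) atTop (𝓝 0) := by
      simpa using ENNReal.Tendsto.mul_const hlim (Or.inr ENNReal.ofReal_ne_top)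
    refine tendsto_of_tendsto_of_tendsto_of_le_of_le tendsto_const_nhds h0 (fun _ => zero_le) ?_
    intro k
    dsimp only
    rw [← lintegral_mul_const' _ _ ENNReal.ofReal_ne_top]
    refine lintegral_mono fun x => ?_
    rw [← sub_mul, enorm_mul]
    gcongr
    rw [← ofReal_norm]
    exact ENNReal.ofReal_le_ofReal (hM x)
  have h1 := aux w w' (fun x => fderiv ℝ φ x e) hw hw' (by fun_prop) (hφc.fderiv_apply ℝ e) hlim
  have h2 := aux (fun k x => H k x i) (fun x => H' x i) φ
    (fun k => (EuclideanSpace.proj i : Pt n →L[ℝ] ℝ).integrable_comp (hH k))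
    ((EuclideanSpace.proj i : Pt n →L[ℝ] ℝ).integrable_comp hH') hφ.continuous hφc (by
      refine tendsto_of_tendsto_of_tendsto_of_le_of_le tendsto_const_nhds hlimH
        (fun _ => zero_le) fun k => lintegral_mono fun x => ?_
      rw [← ofReal_norm, ← ofReal_norm]
      exact ENNReal.ofReal_le_ofReal (PiLp.norm_apply_le (H k x - H' x) i))
  refine tendsto_nhds_unique h1 (h2.neg.congr fun k => ?_)
  exact ((hwg k).2 i φ hφ hφc hφU).symm

end WeakGradient

section ZeroTrace

variable {n : ℕ} {Ω : Set (Pt n)}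

/-- `w` vanishes outside `Ω` and has the square-integrable weak gradient `H` on `ℝⁿ`. -/
structure ZeroTraceGrad (n : ℕ) (Ω : Set (Pt n)) (w : Pt n → ℝ) (H : Pt n → Pt n) : Prop where
  integrable : Integrable w volume
  eq_zero : ∀ x ∉ Ω, w x = 0
  weakGrad : HasWeakGradOn n w H univ
  sq : Integrable (fun x => ‖H x‖ ^ 2) volume

lemma ZeroTraceGrad.memLp {w : Pt n → ℝ} {H : Pt n → Pt n} (h : ZeroTraceGrad n Ω w H) :
    MemLp H 2 volume := by
  have hm : AEStronglyMeasurable H volume := by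
    simpa using h.weakGrad.1.aestronglyMeasurable
  exact (memLp_two_iff_integrable_sq_norm hm).2 h.sq

lemma ZeroTraceGrad.integrable_grad {w : Pt n → ℝ} {H : Pt n → Pt n}
    (h : ZeroTraceGrad n Ω w H) (hΩ : IsBounded Ω) : Integrable H volume := by
  obtain ⟨R, hR⟩ := hΩ.subset_closedBall 0
  have h1 : IntegrableOn H (closedBall 0 R) volume :=
    h.weakGrad.1.integrableOn_compact_subset (subset_univ _) (isCompact_closedBall 0 R)
  have h2 : ∀ᵐ x, x ∈ (closedBall (0 : Pt n) R)ᶜ → H x = 0 :=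
    (h.weakGrad.mono (subset_univ _)).ae_eq_zero isClosed_closedBall.isOpen_compl
      fun x hx => h.eq_zero x fun hxΩ => hx (hR hxΩ)
  rw [← integrable_indicator_iff measurableSet_closedBall] at h1
  refine h1.congr ?_
  filter_upwards [h2] with x hx
  by_cases hxR : x ∈ closedBall (0 : Pt n) R
  · simp [hxR]
  · rw [indicator_of_notMem hxR, hx hxR]

lemma ZeroTraceGrad.grad_ae_eq_zero {w : Pt n → ℝ} {H : Pt n → Pt n}
    (h : ZeroTraceGrad n Ω w H) (hΩ : IsBounded Ω) (hΩm : MeasurableSet Ω) :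
    ∀ᵐ x, x ∉ Ω → H x = 0 := by
  have hi : ∀ i : Fin n, ∀ᵐ x, x ∈ Ωᶜ → H x i = 0 := fun i =>
    ae_eq_zero_of_weakDeriv h.integrable
      ((EuclideanSpace.proj i : Pt n →L[ℝ] ℝ).integrable_comp (h.integrable_grad hΩ))
      (fun φ hφ hφc => h.weakGrad.2 i φ hφ hφc (subset_univ _)) hΩm.compl h.eq_zero
  filter_upwards [ae_all_iff.2 hi] with x hx hxΩ
  ext i
  exact hx i hxΩ

lemma ZeroTraceGrad.linearCombination {w v : Pt n → ℝ} {H K : Pt n → Pt n}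
    (hw : ZeroTraceGrad n Ω w H) (hv : ZeroTraceGrad n Ω v K) (a b : ℝ) :
    ZeroTraceGrad n Ω (fun x => a * w x + b * v x) (fun x => a • H x + b • K x) where
  integrable := (hw.integrable.const_mul a).add (hv.integrable.const_mul b)
  eq_zero x hx := by simp [hw.eq_zero x hx, hv.eq_zero x hx]
  weakGrad := hw.weakGrad.linearCombination hw.integrable.locallyIntegrable
    hv.integrable.locallyIntegrable hv.weakGrad a b
  sq := by
    have := (hw.memLp.const_smul a).add (hv.memLp.const_smul b)
    exact (memLp_two_iff_integrable_sq_norm this.1).1 this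

lemma ZeroTraceGrad.poincare (hn : 1 ≤ n) {w : Pt n → ℝ} {H : Pt n → Pt n}
    (h : ZeroTraceGrad n Ω w H) {R : ℝ} (hR : 0 ≤ R) (hΩ : Ω ⊆ ball 0 R) :
    ∫⁻ x, ‖w x‖ₑ ≤ (∫⁻ x, ‖H x‖ₑ) * ENNReal.ofReal (2 * R) := by
  set i : Fin n := ⟨0, hn⟩
  have h1 := lintegral_enorm_le_of_weakDeriv h.integrable
    ((EuclideanSpace.proj i : Pt n →L[ℝ] ℝ).integrable_comp
      (h.integrable_grad (isBounded_ball.subset hΩ)))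
    (by simp) (fun φ hφ hφc => h.weakGrad.2 i φ hφ hφc (subset_univ _)) hR
    fun x hx => h.eq_zero x fun hxΩ => hx (hΩ hxΩ)
  refine h1.trans ?_
  gcongr with x
  rw [← ofReal_norm, ← ofReal_norm]
  exact ENNReal.ofReal_le_ofReal (PiLp.norm_apply_le (H x) i)

/-- A sequence of functions that vanish outside a bounded open set `Ω` and whose gradients
converge in `L²(Ω)` subconverges almost everywhere to a function of the same kind. -/
lemma ZeroTraceGrad.exists_limit (hn : 1 ≤ n) (hΩ : IsBounded Ω) (hΩm : MeasurableSet Ω)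
    {w : ℕ → Pt n → ℝ} {H : ℕ → Pt n → Pt n} (h : ∀ k, ZeroTraceGrad n Ω (w k) (H k))
    {K : Pt n → Pt n} (hK : MemLp K 2 (volume.restrict Ω))
    (hlim : Tendsto (fun k => eLpNorm (fun x => H k x - K x) 2 (volume.restrict Ω)) atTop (𝓝 0)) :
    ∃ w' : Pt n → ℝ, ZeroTraceGrad n Ω w' (Ω.indicator K) ∧
      ∃ ns : ℕ → ℕ, StrictMono ns ∧
        ∀ᵐ x, Tendsto (fun k => w (ns k) x) atTop (𝓝 (w' x)) := by
  obtain ⟨R₀, hR₀⟩ := hΩ.subset_ball 0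
  obtain ⟨R, hR, hΩR⟩ : ∃ R : ℝ, 0 ≤ R ∧ Ω ⊆ ball 0 R :=
    ⟨max R₀ 0, le_max_right _ _, hR₀.trans (ball_subset_ball (le_max_left _ _))⟩
  have hvol : volume Ω ≠ ∞ := hΩ.measure_lt_top.ne
  have : IsFiniteMeasure (volume.restrict Ω) := ⟨by simpa using hΩ.measure_lt_top⟩
  have hKi : Integrable (Ω.indicator K) volume :=
    (integrable_indicator_iff hΩm).2 (hK.integrable (by norm_num))
  have hK2 : MemLp (Ω.indicator K) 2 volume := (memLp_indicator_iff_restrict hΩm).2 hK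
  -- gradients converge in `L¹`
  have hH1 : ∀ k, ∫⁻ x, ‖H k x - Ω.indicator K x‖ₑ ≤
      eLpNorm (fun x => H k x - K x) 2 (volume.restrict Ω) *
        volume Ω ^ (1 - 1 / 2 : ℝ) := by
    intro k
    have e1 : ∫⁻ x, ‖H k x - Ω.indicator K x‖ₑ = ∫⁻ x in Ω, ‖H k x - K x‖ₑ := by
      rw [← lintegral_indicator hΩm]
      refine lintegral_congr_ae ?_
      filter_upwards [(h k).grad_ae_eq_zero hΩ hΩm] with x hx
      by_cases hxΩ : x ∈ Ω
      · simp [hxΩ]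
      · simp [hxΩ, hx hxΩ]
    have := eLpNorm_le_eLpNorm_mul_rpow_measure_univ (μ := volume.restrict Ω)
      (p := 1) (q := 2) (f := fun x => H k x - K x) (by norm_num)
      ((h k).memLp.1.restrict.sub hK.1)
    rw [e1, ← eLpNorm_one_eq_lintegral_enorm]
    simpa using this
  have hHlim : Tendsto (fun k => ∫⁻ x, ‖H k x - Ω.indicator K x‖ₑ) atTop (𝓝 0) := by
    refine tendsto_of_tendsto_of_tendsto_of_le_of_le tendsto_const_nhds ?_ (fun _ => zero_le) hH1
    have hne : volume Ω ^ (1 - 1 / 2 : ℝ) ≠ ∞ := ENNReal.rpow_ne_top_of_nonneg (by norm_num) hvol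
    simpa using ENNReal.Tendsto.mul_const hlim (Or.inr hne)
  -- the functions form a Cauchy sequence in `L¹`
  set f : ℕ → Lp ℝ 1 (volume : Measure (Pt n)) := fun k => (h k).integrable.toL1 (w k) with hf
  have hdist : ∀ k l, edist (f k) (f l) ≤
      ((∫⁻ x, ‖H k x - Ω.indicator K x‖ₑ) + ∫⁻ x, ‖H l x - Ω.indicator K x‖ₑ) *
        ENNReal.ofReal (2 * R) := by
    intro k l
    rw [hf]
    simp only
    rw [Integrable.edist_toL1_toL1]
    have h1 := ((h k).linearCombination (h l) 1 (-1)).poincare hn hR hΩR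
    have e1 : ∀ x, 1 * w k x + -1 * w l x = w k x - w l x := fun x => by ring
    have e2 : ∀ x, (1 : ℝ) • H k x + (-1 : ℝ) • H l x = H k x - H l x := fun x => by
      simp [sub_eq_add_neg]
    simp_rw [e1, e2] at h1
    simp_rw [edist_eq_enorm_sub]
    refine h1.trans ?_
    gcongr
    have hm : AEMeasurable (fun x => ‖H k x - Ω.indicator K x‖ₑ) volume :=
      (((h k).integrable_grad hΩ).aestronglyMeasurable.sub hKi.aestronglyMeasurable).enorm
    rw [← lintegral_add_left' hm]
    refine lintegral_mono fun x => ?_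
    have : H k x - H l x =
        (H k x - Ω.indicator K x) - (H l x - Ω.indicator K x) := by abel
    simp only
    rw [this]
    exact enorm_sub_le
  have hcauchy : CauchySeq f := by
    rw [EMetric.cauchySeq_iff]
    intro ε hε
    have ht : Tendsto (fun p : ℕ × ℕ => ((∫⁻ x, ‖H p.1 x - Ω.indicator K x‖ₑ) +
        ∫⁻ x, ‖H p.2 x - Ω.indicator K x‖ₑ) * ENNReal.ofReal (2 * R)) atTop (𝓝 0) := by
      rw [← prod_atTop_atTop_eq]
      have := ENNReal.Tendsto.mul_const ((hHlim.comp tendsto_fst).add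
        (hHlim.comp (tendsto_snd (f := (atTop : Filter ℕ)) (g := (atTop : Filter ℕ)))))
        (b := ENNReal.ofReal (2 * R)) (Or.inr ENNReal.ofReal_ne_top)
      simpa using this
    obtain ⟨N, hN⟩ := eventually_atTop.1 (ht.eventually (gt_mem_nhds hε))
    refine ⟨max N.1 N.2, fun k hk l hl => (hdist k l).trans_lt (hN (k, l) ?_)⟩
    exact ⟨(le_max_left _ _).trans hk, (le_max_right _ _).trans hl⟩
  obtain ⟨F, hF⟩ := cauchySeq_tendsto_of_complete hcauchy
  have hFi : Integrable F volume := L1.integrable_coeFn F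
  have hwlim : Tendsto (fun k => ∫⁻ x, ‖w k x - F x‖ₑ) atTop (𝓝 0) := by
    have := tendsto_iff_edist_tendsto_0.1 hF
    refine this.congr fun k => ?_
    rw [← Integrable.toL1_coeFn F hFi, hf]
    simp only
    rw [Integrable.edist_toL1_toL1]
    simp only [edist_eq_enorm_sub, Integrable.toL1_coeFn]
  have hwlim' : Tendsto (fun k => ∫⁻ x, ‖w k x - Ω.indicator F x‖ₑ) atTop (𝓝 0) := by
    refine tendsto_of_tendsto_of_tendsto_of_le_of_le tendsto_const_nhds hwlim (fun _ => zero_le)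
      fun k => lintegral_mono fun x => ?_
    by_cases hx : x ∈ Ω
    · simp [hx]
    · simp [hx, (h k).eq_zero x hx]
  have hFi' : Integrable (Ω.indicator F) volume := hFi.indicator hΩm
  refine ⟨Ω.indicator F, ⟨hFi', fun x hx => indicator_of_notMem hx _,
    HasWeakGradOn.of_tendsto (fun k => (h k).integrable) (fun k => (h k).integrable_grad hΩ)
      (fun k => (h k).weakGrad) hFi' hKi hwlim' hHlim,
    (memLp_two_iff_integrable_sq_norm hK2.1).1 hK2⟩, ?_⟩
  have hmeas : TendstoInMeasure volume w atTop (Ω.indicator F) := by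
    refine tendstoInMeasure_of_tendsto_eLpNorm (p := 1) one_ne_zero
      (fun k => (h k).integrable.aestronglyMeasurable) hFi'.aestronglyMeasurable ?_
    simpa [eLpNorm_one_eq_lintegral_enorm] using hwlim'
  exact hmeas.exists_seq_tendsto_ae

end ZeroTrace

section FractionalPerimeter

variable {n : ℕ} {σ : ℝ} {Ω : Set (Pt n)}

/-- The kernel of the interaction functional. -/
noncomputable def fracKernel (n : ℕ) (σ : ℝ) (x y : Pt n) : ℝ≥0∞ :=
  ENNReal.ofReal (‖x - y‖ ^ (-((n : ℝ) + σ)))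

lemma measurable_fracKernel : Measurable (Function.uncurry (fracKernel n σ)) := by
  unfold fracKernel Function.uncurry
  fun_prop

lemma fracKernel_comm (x y : Pt n) : fracKernel n σ x y = fracKernel n σ y x := by
  rw [fracKernel, fracKernel, norm_sub_rev]

lemma interL_comm (A B : Set (Pt n)) : interL n σ A B = interL n σ B A := by
  have h : interL n σ A B = ∫⁻ x in A, ∫⁻ y in B, fracKernel n σ x y := rfl
  rw [h, lintegral_lintegral_swap measurable_fracKernel.aemeasurable]
  simp_rw [fracKernel_comm (σ := σ)]
  rfl

lemma interL_mono {A B A' B' : Set (Pt n)} (hA : A ⊆ A') (hB : B ⊆ B') :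
    interL n σ A B ≤ interL n σ A' B' :=
  (lintegral_mono_set hA).trans (lintegral_mono fun _ => lintegral_mono_set hB)

lemma interL_union_right (A : Set (Pt n)) {B C : Set (Pt n)} (hC : MeasurableSet C)
    (h : Disjoint B C) : interL n σ A (B ∪ C) = interL n σ A B + interL n σ A C := by
  unfold interL
  rw [← lintegral_add_left]
  · simp_rw [lintegral_union hC h]
  · exact (measurable_fracKernel (n := n) (σ := σ)).lintegral_prod_right'

lemma interL_eq_lintegral_indicator {A B : Set (Pt n)} (hA : MeasurableSet A)
    (hB : MeasurableSet B) :
    interL n σ A B = ∫⁻ x, ∫⁻ y,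
      (A ×ˢ B).indicator (Function.uncurry (fracKernel n σ)) (x, y) := by
  unfold interL
  rw [← lintegral_indicator hA]
  refine lintegral_congr fun x => ?_
  by_cases hx : x ∈ A
  · rw [indicator_of_mem hx, ← lintegral_indicator hB]
    refine lintegral_congr fun y => ?_
    by_cases hy : y ∈ B <;> simp [hx, hy, fracKernel]
  · simp [hx]

/-- Lower semicontinuity of the interaction functional. -/
lemma interL_le_liminf {A B : ℕ → Set (Pt n)} {A' B' : Set (Pt n)}
    (hA : ∀ k, MeasurableSet (A k)) (hB : ∀ k, MeasurableSet (B k)) (hA' : MeasurableSet A')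
    (hB' : MeasurableSet B') (hAA' : ∀ᵐ x, x ∈ A' → ∀ᶠ k in atTop, x ∈ A k)
    (hBB' : ∀ᵐ x, x ∈ B' → ∀ᶠ k in atTop, x ∈ B k) :
    interL n σ A' B' ≤ liminf (fun k => interL n σ (A k) (B k)) atTop := by
  rw [interL_eq_lintegral_indicator hA' hB',
    funext fun k => interL_eq_lintegral_indicator (n := n) (σ := σ) (hA k) (hB k)]
  have hmeas : ∀ k, Measurable ((A k ×ˢ B k).indicator (Function.uncurry (fracKernel n σ))) :=
    fun k => measurable_fracKernel.indicator ((hA k).prod (hB k))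
  refine le_trans ?_ (lintegral_liminf_le fun k => (hmeas k).lintegral_prod_right')
  refine lintegral_mono_ae ?_
  filter_upwards [hAA'] with x hx
  refine le_trans ?_ (lintegral_liminf_le fun k => (hmeas k).comp measurable_prodMk_left)
  refine lintegral_mono_ae ?_
  filter_upwards [hBB'] with y hy
  by_cases hxy : (x, y) ∈ A' ×ˢ B'
  · refine le_liminf_of_le (by isBoundedDefault) ?_
    filter_upwards [hx hxy.1, hy hxy.2] with k hxk hyk
    simp [indicator_of_mem hxy, indicator_of_mem (mk_mem_prod hxk hyk)]
  · simp [indicator_of_notMem hxy]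

lemma ENNReal.liminf_add_liminf_le (a b : ℕ → ℝ≥0∞) :
    liminf a atTop + liminf b atTop ≤ liminf (fun k => a k + b k) atTop := by
  simp_rw [liminf_eq_iSup_iInf_of_nat]
  rw [ENNReal.iSup_add_iSup_of_monotone]
  · exact iSup_mono fun i => le_iInf₂ fun j hj =>
      add_le_add (iInf₂_le j hj) (iInf₂_le j hj)
  · exact fun i j hij => biInf_mono fun k hk => hij.trans hk
  · exact fun i j hij => biInf_mono fun k hk => hij.trans hk

/-- Lower semicontinuity of the fractional perimeter. -/
lemma fracPer_le_liminf {E : ℕ → Set (Pt n)} {E' : Set (Pt n)} (hΩ : MeasurableSet Ω)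
    (hE : ∀ k, MeasurableSet (E k)) (hE' : MeasurableSet E')
    (h : ∀ᵐ x, ∀ᶠ k in atTop, x ∈ E k ↔ x ∈ E') :
    fracPer n σ E' Ω ≤ liminf (fun k => fracPer n σ (E k) Ω) atTop := by
  have hin : ∀ D : Set (Pt n), ∀ᵐ x, x ∈ E' ∩ D → ∀ᶠ k in atTop, x ∈ E k ∩ D := fun D => by
    filter_upwards [h] with x hx hxE
    filter_upwards [hx] with k hk
    exact ⟨hk.2 hxE.1, hxE.2⟩
  have hout : ∀ D : Set (Pt n), ∀ᵐ x, x ∈ E'ᶜ ∩ D → ∀ᶠ k in atTop, x ∈ (E k)ᶜ ∩ D := fun D => by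
    filter_upwards [h] with x hx hxE
    filter_upwards [hx] with k hk
    exact ⟨fun hxk => hxE.1 (hk.1 hxk), hxE.2⟩
  refine le_trans (add_le_add ?_ ?_) (ENNReal.liminf_add_liminf_le _ _)
  · exact interL_le_liminf (fun k => (hE k).inter hΩ) (fun k => (hE k).compl) (hE'.inter hΩ)
      hE'.compl (hin Ω) (by simpa using hout univ)
  · exact interL_le_liminf (fun k => (hE k).compl.inter hΩ) (fun k => (hE k).inter hΩ.compl)
      (hE'.compl.inter hΩ) (hE'.inter hΩ.compl) (hout Ω) (hin Ωᶜ)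

/-- The interaction of the point `x` with the points on the other side of `E`. -/
noncomputable def crossInteraction (n : ℕ) (σ : ℝ) (E : Set (Pt n)) (x : Pt n) : ℝ≥0∞ :=
  ∫⁻ y, ‖E.indicator (1 : Pt n → ℝ) x - E.indicator 1 y‖ₑ * fracKernel n σ x y

lemma measurable_crossInteraction {E : Set (Pt n)} (hE : MeasurableSet E) :
    Measurable (crossInteraction n σ E) := by
  have h1 : Measurable (E.indicator (1 : Pt n → ℝ)) := measurable_one.indicator hE
  have : Measurable fun p : Pt n × Pt n =>
      ‖E.indicator (1 : Pt n → ℝ) p.1 - E.indicator 1 p.2‖ₑ * fracKernel n σ p.1 p.2 :=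
    ((h1.comp measurable_fst).sub (h1.comp measurable_snd)).enorm.mul measurable_fracKernel
  exact this.lintegral_prod_right'

lemma setLIntegral_crossInteraction_le {E : Set (Pt n)} (hE : MeasurableSet E)
    (hΩ : MeasurableSet Ω) :
    ∫⁻ x in Ω, crossInteraction n σ E x ≤ 2 * fracPer n σ E Ω := by
  have hin : ∀ x ∈ E, crossInteraction n σ E x = ∫⁻ y in Eᶜ, fracKernel n σ x y := by
    intro x hx
    rw [crossInteraction, ← lintegral_indicator hE.compl]
    refine lintegral_congr fun y => ?_
    by_cases hy : y ∈ E <;> simp [hx, hy]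
  have hout : ∀ x ∈ Eᶜ, crossInteraction n σ E x = ∫⁻ y in E, fracKernel n σ x y := by
    intro x hx
    rw [crossInteraction, ← lintegral_indicator hE]
    refine lintegral_congr fun y => ?_
    have hx' : x ∉ E := hx
    by_cases hy : y ∈ E <;> simp [hx', hy]
  have h1 : ∫⁻ x in E ∩ Ω, crossInteraction n σ E x = interL n σ (E ∩ Ω) Eᶜ :=
    setLIntegral_congr_fun (hE.inter hΩ) fun x hx => hin x hx.1
  have h2 : ∫⁻ x in Eᶜ ∩ Ω, crossInteraction n σ E x = interL n σ (Eᶜ ∩ Ω) E :=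
    setLIntegral_congr_fun (hE.compl.inter hΩ) fun x hx => hout x hx.1
  have h3 : ∫⁻ x in Ω, crossInteraction n σ E x =
      interL n σ (E ∩ Ω) Eᶜ + interL n σ (Eᶜ ∩ Ω) E := by
    rw [← h1, ← h2, ← lintegral_inter_add_sdiff _ Ω hE, inter_comm Ω E, sdiff_eq, inter_comm Ω Eᶜ]
  have h4 : interL n σ (Eᶜ ∩ Ω) E =
      interL n σ (Eᶜ ∩ Ω) (E ∩ Ωᶜ) + interL n σ (Eᶜ ∩ Ω) (E ∩ Ω) := by
    rw [← interL_union_right _ (hE.inter hΩ), ← inter_union_distrib_left, compl_union_self,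
      inter_univ]
    exact disjoint_compl_left.mono inter_subset_right inter_subset_right
  have h5 : interL n σ (Eᶜ ∩ Ω) (E ∩ Ω) ≤ interL n σ (E ∩ Ω) Eᶜ := by
    rw [interL_comm]
    exact interL_mono le_rfl inter_subset_left
  rw [h3, h4, fracPer, two_mul]
  calc _ ≤ interL n σ (E ∩ Ω) Eᶜ + (interL n σ (Eᶜ ∩ Ω) (E ∩ Ωᶜ) + interL n σ (E ∩ Ω) Eᶜ) := by
        gcongr
    _ = interL n σ (E ∩ Ω) Eᶜ + interL n σ (Eᶜ ∩ Ω) (E ∩ Ωᶜ) + interL n σ (E ∩ Ω) Eᶜ := by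
        rw [add_assoc]
    _ ≤ _ := by gcongr; exact le_self_add

end FractionalPerimeter

section GridCompactness

variable {n : ℕ} {σ : ℝ} {Ω : Set (Pt n)}

/-- The index of the cell of the cubic grid of side length `1 / (m + 1)` containing `x`. -/
noncomputable def gridIndex (n m : ℕ) (x : Pt n) : Fin n → ℤ := fun i => ⌊((m : ℝ) + 1) * x i⌋

lemma measurable_gridIndex (m : ℕ) : Measurable (gridIndex n m) := by
  refine measurable_pi_lambda _ fun i => Int.measurable_floor.comp ?_
  fun_prop

lemma volume_gridCell (m : ℕ) (j : Fin n → ℤ) :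
    volume (gridIndex n m ⁻¹' {j}) = ENNReal.ofReal ((1 / ((m : ℝ) + 1)) ^ n) := by
  have hm : (0 : ℝ) < (m : ℝ) + 1 := by positivity
  have h : gridIndex n m ⁻¹' {j} = WithLp.ofLp ⁻¹'
      (univ.pi fun i => Ico ((j i : ℝ) / ((m : ℝ) + 1)) (((j i : ℝ) + 1) / ((m : ℝ) + 1))) := by
    ext x
    simp only [mem_preimage, mem_singleton_iff, funext_iff, gridIndex, Int.floor_eq_iff, Set.mem_pi,
      mem_univ, true_implies, mem_Ico, div_le_iff₀ hm, lt_div_iff₀ hm, mul_comm]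
  rw [h, (PiLp.volume_preserving_ofLp (Fin n)).measure_preimage
    (MeasurableSet.univ_pi fun i => measurableSet_Ico).nullMeasurableSet, volume_pi_pi]
  simp_rw [Real.volume_Ico, ← sub_div, add_sub_cancel_left]
  rw [Finset.prod_const, Finset.card_univ, Fintype.card_fin, ENNReal.ofReal_pow (by positivity)]

lemma norm_sub_le_of_gridIndex_eq {m : ℕ} {x y : Pt n} (h : gridIndex n m x = gridIndex n m y) :
    ‖x - y‖ ≤ √n * (1 / ((m : ℝ) + 1)) := by
  have hm : (0 : ℝ) < (m : ℝ) + 1 := by positivity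
  have hi : ∀ i, ‖(x - y) i‖ ^ 2 ≤ (1 / ((m : ℝ) + 1)) ^ 2 := by
    intro i
    have h1 := Int.abs_sub_lt_one_of_floor_eq_floor (congrFun h i)
    rw [← mul_sub, abs_mul, abs_of_pos hm] at h1
    have h2 : ‖(x - y) i‖ ≤ 1 / ((m : ℝ) + 1) := by
      rw [le_div_iff₀ hm, mul_comm, PiLp.sub_apply, Real.norm_eq_abs]
      exact h1.le
    gcongr
  rw [EuclideanSpace.norm_eq]
  calc √(∑ i, ‖(x - y) i‖ ^ 2) ≤ √(∑ _i : Fin n, (1 / ((m : ℝ) + 1)) ^ 2) :=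
        Real.sqrt_le_sqrt (Finset.sum_le_sum fun i _ => hi i)
    _ = √n * (1 / ((m : ℝ) + 1)) := by
        rw [Finset.sum_const, Finset.card_univ, Fintype.card_fin, nsmul_eq_mul,
          Real.sqrt_mul (by positivity), Real.sqrt_sq (by positivity)]

lemma one_le_mul_fracKernel (hσ : 0 ≤ σ) {m : ℕ} {x y : Pt n}
    (h : gridIndex n m x = gridIndex n m y) (hxy : x ≠ y) :
    1 ≤ ENNReal.ofReal ((√n * (1 / ((m : ℝ) + 1))) ^ ((n : ℝ) + σ)) * fracKernel n σ x y := by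
  have hpos : 0 < ‖x - y‖ := norm_pos_iff.2 (sub_ne_zero.2 hxy)
  rw [fracKernel, ← ENNReal.ofReal_mul (by positivity), ENNReal.one_le_ofReal,
    Real.rpow_neg hpos.le, ← div_eq_mul_inv, one_le_div (by positivity)]
  exact Real.rpow_le_rpow hpos.le (norm_sub_le_of_gridIndex_eq h) (by positivity)

lemma setLIntegral_gridCell_le (hσ : 0 ≤ σ) (m : ℕ) (E : Set (Pt n)) (x : Pt n) :
    ∫⁻ y in gridIndex n m ⁻¹' {gridIndex n m x},
        ‖E.indicator (1 : Pt n → ℝ) x - E.indicator 1 y‖ₑ ≤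
      ENNReal.ofReal ((√n * (1 / ((m : ℝ) + 1))) ^ ((n : ℝ) + σ)) * crossInteraction n σ E x := by
  have hQ : MeasurableSet (gridIndex n m ⁻¹' {gridIndex n m x}) :=
    measurable_gridIndex m (measurableSet_singleton _)
  rw [crossInteraction, ← lintegral_const_mul' _ _ ENNReal.ofReal_ne_top]
  refine (setLIntegral_mono' hQ fun y hy => ?_).trans (setLIntegral_le_lintegral _ _)
  by_cases hxy : x = y
  · simp [hxy]
  · rw [mul_left_comm]
    exact le_mul_of_one_le_right' (one_le_mul_fracKernel hσ (mem_singleton_iff.1 hy).symm hxy)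

/-- A function is estimated by its mean over a grid cell and its interaction energy. -/
lemma volume_mul_enorm_indicator_sub_le (hσ : 0 ≤ σ) (m : ℕ) {E F : Set (Pt n)}
    (hE : MeasurableSet E) (hF : MeasurableSet F) (x : Pt n) :
    ENNReal.ofReal ((1 / ((m : ℝ) + 1)) ^ n) *
        ‖E.indicator (1 : Pt n → ℝ) x - F.indicator 1 x‖ₑ ≤
      ENNReal.ofReal ((√n * (1 / ((m : ℝ) + 1))) ^ ((n : ℝ) + σ)) *
          (crossInteraction n σ E x + crossInteraction n σ F x) +
        ‖volume.real (gridIndex n m ⁻¹' {gridIndex n m x} ∩ E) -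
          volume.real (gridIndex n m ⁻¹' {gridIndex n m x} ∩ F)‖ₑ := by
  set Q := gridIndex n m ⁻¹' {gridIndex n m x} with hQdef
  have hQ : MeasurableSet Q := measurable_gridIndex m (measurableSet_singleton _)
  have hQv : volume Q = ENNReal.ofReal ((1 / ((m : ℝ) + 1)) ^ n) := volume_gridCell m _
  have hQfin : volume Q ≠ ∞ := by rw [hQv]; exact ENNReal.ofReal_ne_top
  have hint : ∀ {A : Set (Pt n)}, MeasurableSet A →
      IntegrableOn (A.indicator (1 : Pt n → ℝ)) Q volume := fun hA =>
    (integrableOn_const (C := (1 : ℝ)) hQfin).indicator hA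
  have hval : ∀ {A : Set (Pt n)}, MeasurableSet A →
      ∫ y in Q, A.indicator (1 : Pt n → ℝ) y = volume.real (Q ∩ A) := fun hA => by
    rw [integral_indicator_one hA, measureReal_restrict_apply hA, inter_comm]
  set c := E.indicator (1 : Pt n → ℝ) x - F.indicator 1 x with hc
  have hEF : IntegrableOn (fun y => E.indicator (1 : Pt n → ℝ) y - F.indicator 1 y) Q volume :=
    (hint hE).sub (hint hF)
  have hconst : IntegrableOn (fun _ : Pt n => c) Q volume := integrableOn_const hQfin
  have hsplit : volume.real Q * c =
      (∫ y in Q, (c - (E.indicator (1 : Pt n → ℝ) y - F.indicator 1 y))) +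
        (volume.real (Q ∩ E) - volume.real (Q ∩ F)) := by
    rw [integral_sub hconst hEF, integral_sub (hint hE) (hint hF), hval hE, hval hF,
      sub_add_cancel, setIntegral_const, smul_eq_mul]
  have hnorm : ENNReal.ofReal ((1 / ((m : ℝ) + 1)) ^ n) * ‖c‖ₑ = ‖volume.real Q * c‖ₑ := by
    rw [enorm_mul, ← hQv, Real.enorm_of_nonneg measureReal_nonneg, ofReal_measureReal hQfin]
  rw [hnorm, hsplit, mul_add]
  refine (enorm_add_le _ _).trans (add_le_add ?_ le_rfl)
  refine (enorm_integral_le_lintegral_enorm _).trans ?_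
  refine le_trans ?_ (add_le_add (setLIntegral_gridCell_le hσ m E x)
    (setLIntegral_gridCell_le hσ m F x))
  rw [← lintegral_add_left]
  · refine lintegral_mono fun y => ?_
    rw [hc, sub_sub_sub_comm]
    exact enorm_sub_le
  · exact (measurable_const.sub (measurable_one.indicator hE)).enorm

lemma volume_inter_symmDiff_le (hσ : 0 ≤ σ) (hΩ : MeasurableSet Ω) (m : ℕ) {E F : Set (Pt n)}
    (hE : MeasurableSet E) (hF : MeasurableSet F) {C : ℝ≥0∞} (hEC : fracPer n σ E Ω ≤ C)
    (hFC : fracPer n σ F Ω ≤ C) :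
    volume (Ω ∩ (E ∆ F)) ≤ ENNReal.ofReal (√n ^ ((n : ℝ) + σ) * (1 / ((m : ℝ) + 1)) ^ σ) * (4 * C) +
      (ENNReal.ofReal ((1 / ((m : ℝ) + 1)) ^ n))⁻¹ *
        ∫⁻ x in Ω, ‖volume.real (gridIndex n m ⁻¹' {gridIndex n m x} ∩ E) -
          volume.real (gridIndex n m ⁻¹' {gridIndex n m x} ∩ F)‖ₑ := by
  set V := ENNReal.ofReal ((1 / ((m : ℝ) + 1)) ^ n) with hV
  have hV0 : V ≠ 0 := by
    rw [hV, ENNReal.ofReal_ne_zero_iff]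
    positivity
  have hVtop : V ≠ ∞ := ENNReal.ofReal_ne_top
  have hscale : ENNReal.ofReal ((√n * (1 / ((m : ℝ) + 1))) ^ ((n : ℝ) + σ)) =
      V * ENNReal.ofReal (√n ^ ((n : ℝ) + σ) * (1 / ((m : ℝ) + 1)) ^ σ) := by
    rw [hV, ← ENNReal.ofReal_mul (by positivity), Real.mul_rpow (by positivity) (by positivity),
      Real.rpow_add (x := 1 / ((m : ℝ) + 1)) (by positivity), Real.rpow_natCast]
    congr 1
    ring
  have hind : ∀ x, ‖E.indicator (1 : Pt n → ℝ) x - F.indicator 1 x‖ₑ =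
      (E ∆ F).indicator 1 x := by
    intro x
    by_cases hxE : x ∈ E <;> by_cases hxF : x ∈ F <;> simp [hxE, hxF, mem_symmDiff]
  have hvol : volume (Ω ∩ (E ∆ F)) =
      ∫⁻ x in Ω, ‖E.indicator (1 : Pt n → ℝ) x - F.indicator 1 x‖ₑ := by
    simp_rw [hind]
    rw [lintegral_indicator_one (hE.symmDiff hF), Measure.restrict_apply (hE.symmDiff hF),
      inter_comm]
  have hmain : V * volume (Ω ∩ (E ∆ F)) ≤
      V * (ENNReal.ofReal (√n ^ ((n : ℝ) + σ) * (1 / ((m : ℝ) + 1)) ^ σ) * (4 * C)) +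
        ∫⁻ x in Ω, ‖volume.real (gridIndex n m ⁻¹' {gridIndex n m x} ∩ E) -
          volume.real (gridIndex n m ⁻¹' {gridIndex n m x} ∩ F)‖ₑ := by
    rw [hvol, ← lintegral_const_mul' _ _ hVtop]
    refine (lintegral_mono fun x => volume_mul_enorm_indicator_sub_le hσ m hE hF x).trans ?_
    have hmE := measurable_crossInteraction (σ := σ) hE
    have hmF := measurable_crossInteraction (σ := σ) hF
    have hmEF : Measurable fun x => crossInteraction n σ E x + crossInteraction n σ F x :=
      hmE.add hmF
    rw [lintegral_add_left (hmEF.const_mul _), 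
      lintegral_const_mul' _ _ ENNReal.ofReal_ne_top, lintegral_add_left hmE, hscale, mul_assoc]
    gcongr
    calc _ ≤ 2 * C + 2 * C := add_le_add
          ((setLIntegral_crossInteraction_le hE hΩ).trans (by gcongr))
          ((setLIntegral_crossInteraction_le hF hΩ).trans (by gcongr))
      _ = 4 * C := by rw [← add_mul]; norm_num
  calc volume (Ω ∩ (E ∆ F)) = V⁻¹ * (V * volume (Ω ∩ (E ∆ F))) := by
        rw [← mul_assoc, ENNReal.inv_mul_cancel hV0 hVtop, one_mul]
    _ ≤ V⁻¹ * (V * (ENNReal.ofReal (√n ^ ((n : ℝ) + σ) * (1 / ((m : ℝ) + 1)) ^ σ) * (4 * C)) +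
        ∫⁻ x in Ω, ‖volume.real (gridIndex n m ⁻¹' {gridIndex n m x} ∩ E) -
          volume.real (gridIndex n m ⁻¹' {gridIndex n m x} ∩ F)‖ₑ) := by gcongr
    _ = _ := by rw [mul_add, ← mul_assoc, ENNReal.inv_mul_cancel hV0 hVtop, one_mul]

lemma volume_real_gridCell_inter_le (m : ℕ) (j : Fin n → ℤ) (E : Set (Pt n)) :
    volume.real (gridIndex n m ⁻¹' {j} ∩ E) ≤ 1 := by
  have hle : volume (gridIndex n m ⁻¹' {j}) ≤ 1 := by
    rw [volume_gridCell, ENNReal.ofReal_le_one]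
    refine pow_le_one₀ (by positivity) ?_
    rw [div_le_one (by positivity)]
    linarith [Nat.cast_nonneg (α := ℝ) m]
  exact ENNReal.toReal_le_of_le_ofReal zero_le_one
    ((measure_mono inter_subset_left).trans (by simpa using hle))

lemma exists_forall_volume_symmDiff_le (hσ : 0 < σ) (hΩ : MeasurableSet Ω)
    (hΩv : volume Ω ≠ ∞) {E : ℕ → Set (Pt n)} (hE : ∀ k, MeasurableSet (E k)) {C : ℝ≥0∞}
    (hC : C ≠ ∞) (hEC : ∀ k, fracPer n σ (E k) Ω ≤ C)
    (hlim : ∀ m j, ∃ a, Tendsto (fun k => volume.real (gridIndex n m ⁻¹' {j} ∩ E k)) atTop (𝓝 a))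
    {ε : ℝ≥0∞} (hε : 0 < ε) : ∃ N, ∀ k ≥ N, ∀ l ≥ N, volume (Ω ∩ (E k ∆ E l)) ≤ ε := by
  have hD : Tendsto (fun m : ℕ =>
      ENNReal.ofReal (√n ^ ((n : ℝ) + σ) * (1 / ((m : ℝ) + 1)) ^ σ) * (4 * C)) atTop (𝓝 0) := by
    have h1 : Tendsto (fun m : ℕ => √n ^ ((n : ℝ) + σ) * (1 / ((m : ℝ) + 1)) ^ σ) atTop (𝓝 0) := by
      have := (tendsto_one_div_add_atTop_nhds_zero_nat (𝕜 := ℝ)).rpow_const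
        (p := σ) (Or.inr hσ.le)
      rw [Real.zero_rpow hσ.ne'] at this
      simpa using this.const_mul (√n ^ ((n : ℝ) + σ))
    have h2 := ENNReal.Tendsto.mul_const (b := 4 * C) (ENNReal.tendsto_ofReal h1)
      (Or.inr (ENNReal.mul_ne_top (by norm_num) hC))
    simpa using h2
  obtain ⟨m, hm⟩ := (hD.eventually_lt_const (ENNReal.half_pos hε.ne')).exists
  choose a ha using hlim m
  have hR : Tendsto (fun p : ℕ × ℕ =>
      ∫⁻ x in Ω, ‖volume.real (gridIndex n m ⁻¹' {gridIndex n m x} ∩ E p.1) -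
        volume.real (gridIndex n m ⁻¹' {gridIndex n m x} ∩ E p.2)‖ₑ)
      (atTop ×ˢ atTop) (𝓝 (∫⁻ _ in Ω, 0)) := by
    refine tendsto_lintegral_filter_of_dominated_convergence (fun _ => 2) ?_ ?_ ?_ ?_
    · refine Eventually.of_forall fun p => ?_
      exact (measurable_of_countable (f := fun j : Fin n → ℤ =>
        ‖volume.real (gridIndex n m ⁻¹' {j} ∩ E p.1) -
          volume.real (gridIndex n m ⁻¹' {j} ∩ E p.2)‖ₑ)).comp (measurable_gridIndex m)
    · refine Eventually.of_forall fun p => Eventually.of_forall fun x => ?_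
      refine enorm_sub_le.trans ?_
      rw [Real.enorm_of_nonneg measureReal_nonneg, Real.enorm_of_nonneg measureReal_nonneg]
      refine le_of_le_of_eq ?_ (one_add_one_eq_two (R := ℝ≥0∞))
      exact add_le_add
        (ENNReal.ofReal_le_one.2 (volume_real_gridCell_inter_le _ _ _))
        (ENNReal.ofReal_le_one.2 (volume_real_gridCell_inter_le _ _ _))
    · simpa using ENNReal.mul_ne_top (by norm_num) hΩv
    · refine Eventually.of_forall fun x => ?_
      have h₁ := (ha (gridIndex n m x)).comp (tendsto_fst (f := atTop) (g := (atTop : Filter ℕ)))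
      have h₂ := (ha (gridIndex n m x)).comp (tendsto_snd (f := (atTop : Filter ℕ)) (g := atTop))
      simpa using (h₁.sub h₂).enorm
  have hR' := ENNReal.Tendsto.const_mul
    (a := (ENNReal.ofReal ((1 / ((m : ℝ) + 1)) ^ n))⁻¹) hR
    (Or.inr (ENNReal.inv_ne_top.2 (by rw [ENNReal.ofReal_ne_zero_iff]; positivity)))
  rw [lintegral_zero, mul_zero, prod_atTop_atTop_eq] at hR'
  obtain ⟨⟨N₁, N₂⟩, hN⟩ :=
    eventually_atTop.1 (hR'.eventually_lt_const (ENNReal.half_pos hε.ne'))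
  refine ⟨max N₁ N₂, fun k hk l hl => ?_⟩
  refine (volume_inter_symmDiff_le hσ.le hΩ m (hE k) (hE l) (hEC k) (hEC l)).trans ?_
  rw [← ENNReal.add_halves ε]
  exact add_le_add hm.le (hN (k, l) ⟨(le_max_left _ _).trans hk, (le_max_right _ _).trans hl⟩).le

/-- Sets of bounded fractional perimeter with prescribed exterior data are sequentially
precompact. -/
theorem exists_subseq_ae_eventually_mem_iff (hσ : 0 < σ) (hΩ : MeasurableSet Ω)
    (hΩv : volume Ω ≠ ∞) {E : ℕ → Set (Pt n)} (hE : ∀ k, MeasurableSet (E k)) {C : ℝ≥0∞}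
    (hC : C ≠ ∞) (hEC : ∀ k, fracPer n σ (E k) Ω ≤ C) {E₀ : Set (Pt n)}
    (hE₀ : ∀ k, volume ((E k \ Ω) ∆ (E₀ \ Ω)) = 0) :
    ∃ ns : ℕ → ℕ, StrictMono ns ∧ ∃ E' : Set (Pt n), MeasurableSet E' ∧
      ∀ᵐ x, ∀ᶠ k in atTop, x ∈ E (ns k) ↔ x ∈ E' := by
  have hmem : ∀ k, (fun p : ℕ × (Fin n → ℤ) => volume.real (gridIndex n p.1 ⁻¹' {p.2} ∩ E k)) ∈
      univ.pi fun _ : ℕ × (Fin n → ℤ) => Icc (0 : ℝ) 1 := fun k p _ =>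
    ⟨measureReal_nonneg, volume_real_gridCell_inter_le _ _ _⟩
  obtain ⟨a, -, φ, hφ, hlim⟩ :=
    (isCompact_univ_pi fun _ : ℕ × (Fin n → ℤ) => isCompact_Icc).tendsto_subseq hmem
  have hcauchy : ∀ i : ℕ, ∃ N, ∀ k ≥ N, ∀ l ≥ N,
      volume (Ω ∩ (E (φ k) ∆ E (φ l))) ≤ (2 : ℝ≥0∞)⁻¹ ^ i := fun i =>
    exists_forall_volume_symmDiff_le hσ hΩ hΩv (fun k => hE (φ k)) hC (fun k => hEC (φ k))
      (fun m j => ⟨a (m, j), (tendsto_pi_nhds.1 hlim) (m, j)⟩)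
      (ENNReal.pow_pos (ENNReal.inv_pos.2 (by norm_num)) i)
  obtain ⟨ψ, hψ, hψb⟩ := extraction_forall_of_eventually'
    (P := fun i N => ∀ k ≥ N, ∀ l ≥ N,
      volume (Ω ∩ (E (φ k) ∆ E (φ l))) ≤ (2 : ℝ≥0∞)⁻¹ ^ i) fun i => by
    obtain ⟨N, hN⟩ := hcauchy i
    exact ⟨N, fun M hM k hk l hl => hN k (hM.trans hk) l (hM.trans hl)⟩
  have hBC : ∀ᵐ x, ∀ᶠ i in atTop, x ∉ Ω ∩ (E (φ (ψ i)) ∆ E (φ (ψ (i + 1)))) := by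
    refine ae_eventually_notMem (ne_top_of_le_ne_top ?_ (ENNReal.tsum_le_tsum fun i =>
      hψb i (ψ i) le_rfl (ψ (i + 1)) (hψ (Nat.lt_succ_self i)).le))
    rw [ENNReal.tsum_geometric, ENNReal.one_sub_inv_two, inv_inv]
    norm_num
  have hout : ∀ᵐ x, ∀ k, x ∉ (E k \ Ω) ∆ (E₀ \ Ω) :=
    ae_all_iff.2 fun k => measure_eq_zero_iff_ae_notMem.1 (hE₀ k)
  refine ⟨φ ∘ ψ, hφ.comp hψ, {x | ∀ᶠ i in atTop, x ∈ E (φ (ψ i))}, ?_, ?_⟩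
  · have h := MeasurableSet.measurableSet_liminf fun i => hE (φ (ψ i))
    convert h using 1
    ext x
    simp [mem_liminf_iff_eventually_mem]
  filter_upwards [hBC, hout] with x hx hxo
  by_cases hxΩ : x ∈ Ω
  · obtain ⟨N, hN⟩ := eventually_atTop.1 hx
    have hconst : ∀ i ≥ N, (x ∈ E (φ (ψ i)) ↔ x ∈ E (φ (ψ N))) := by
      intro i hi
      induction i, hi using Nat.le_induction with
      | base => rfl
      | succ i hi ih =>
        rw [← ih]
        have := hN i hi
        simp only [mem_inter_iff, hxΩ, true_and, mem_symmDiff] at this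
        tauto
    refine eventually_atTop.2 ⟨N, fun i hi => ?_⟩
    change x ∈ E (φ (ψ i)) ↔ ∀ᶠ i in atTop, x ∈ E (φ (ψ i))
    rw [hconst i hi, eventually_atTop]
    refine ⟨fun h => ⟨N, fun b hb => (hconst b hb).2 h⟩, fun ⟨M, hM⟩ => ?_⟩
    exact (hconst _ (le_max_right M N)).1 (hM _ (le_max_left M N))
  · have hk : ∀ k, x ∈ E k ↔ x ∈ E₀ := by
      intro k
      have := hxo k
      simp only [mem_symmDiff, Set.mem_sdiff, hxΩ, not_false_eq_true, and_true] at this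
      tauto
    refine Eventually.of_forall fun i => ?_
    change x ∈ E (φ (ψ i)) ↔ ∀ᶠ i in atTop, x ∈ E (φ (ψ i))
    simp only [hk, eventually_const]

end GridCompactness

/-- In a decreasing sequence of midpoint-convex sets of a Hilbert space, almost minimizers of the
norm converge. -/
lemma exists_tendsto_of_antitone_of_midpoint {X : Type*} [NormedAddCommGroup X]
    [InnerProductSpace ℝ X] [CompleteSpace X] {S : ℕ → Set X} (hS : Antitone S)
    (hmid : ∀ k, ∀ x ∈ S k, ∀ y ∈ S k, (1 / 2 : ℝ) • x + (1 / 2 : ℝ) • y ∈ S k) {x : ℕ → X}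
    (hx : ∀ k, x k ∈ S k) {ρ : ℝ} (hρ : Tendsto (fun k => ‖x k‖) atTop (𝓝 ρ)) :
    ∃ (g : ℕ → X) (g' : X), (∀ k, g k ∈ S k) ∧ Tendsto g atTop (𝓝 g') ∧ ‖g'‖ ≤ ρ := by
  set d : ℕ → ℝ := fun k => sInf (norm '' S k) with hd
  have hbdd : ∀ k, BddBelow (norm '' S k) := fun k =>
    ⟨0, by rintro _ ⟨y, -, rfl⟩; exact norm_nonneg y⟩
  have hdle : ∀ k, ∀ y ∈ S k, d k ≤ ‖y‖ := fun k y hy => csInf_le (hbdd k) (mem_image_of_mem _ hy)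
  have hdmono : Monotone d := fun k l hkl =>
    csInf_le_csInf (hbdd k) ⟨_, mem_image_of_mem _ (hx l)⟩ (image_mono (hS hkl))
  have hdρ : ∀ k, d k ≤ ρ := fun k => ge_of_tendsto hρ <| by
    filter_upwards [eventually_ge_atTop k] with j hj
    exact hdle k _ (hS hj (hx j))
  have hdnonneg : ∀ k, 0 ≤ d k := fun k =>
    le_csInf ⟨_, mem_image_of_mem _ (hx k)⟩ (by rintro _ ⟨y, -, rfl⟩; exact norm_nonneg y)
  obtain ⟨D, hD⟩ : ∃ D, Tendsto d atTop (𝓝 D) :=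
    ⟨_, tendsto_atTop_ciSup hdmono ⟨ρ, by rintro _ ⟨k, rfl⟩; exact hdρ k⟩⟩
  have hex : ∀ k : ℕ, ∃ y ∈ S k, ‖y‖ < d k + 1 / ((k : ℝ) + 1) := fun k => by
    obtain ⟨_, ⟨y, hy, rfl⟩, hlt⟩ := exists_lt_of_csInf_lt
      (s := norm '' S k) ⟨_, mem_image_of_mem _ (hx k)⟩
      (lt_add_of_pos_right (d k) (by positivity : 0 < 1 / ((k : ℝ) + 1)))
    exact ⟨y, hy, hlt⟩
  choose g hg hgd using hex
  have hnorm : Tendsto (fun k => ‖g k‖) atTop (𝓝 D) := by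
    refine tendsto_of_tendsto_of_tendsto_of_le_of_le hD ?_ (fun k => hdle k _ (hg k))
      fun k => (hgd k).le
    simpa using hD.add (tendsto_one_div_add_atTop_nhds_zero_nat (𝕜 := ℝ))
  have hcauchy : CauchySeq g := by
    rw [Metric.cauchySeq_iff']
    intro ε hε
    have h1 := (hnorm.pow 2).eventually_lt_const (lt_add_of_pos_right (D ^ 2)
      (by positivity : 0 < ε ^ 2 / 16))
    have h2 := (hD.pow 2).eventually_const_lt (sub_lt_self (D ^ 2)
      (by positivity : 0 < ε ^ 2 / 16))
    obtain ⟨N, hN⟩ := eventually_atTop.1 (h1.and h2)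
    refine ⟨N, fun l hl => ?_⟩
    have hmidN := hdle N _ (hmid N _ (hS hl (hg l)) _ (hg N))
    rw [← smul_add, norm_smul, Real.norm_of_nonneg (by norm_num)] at hmidN
    have hpar := parallelogram_law_with_norm ℝ (g l) (g N)
    have hsq : (d N) ^ 2 ≤ (1 / 2 * ‖g l + g N‖) ^ 2 := by
      have := hdnonneg N
      gcongr
    rw [dist_eq_norm]
    refine lt_of_pow_lt_pow_left₀ 2 hε.le ?_
    nlinarith [(hN l hl).1, (hN N le_rfl).1, (hN N le_rfl).2]
  obtain ⟨g', hg'⟩ := cauchySeq_tendsto_of_complete hcauchy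
  refine ⟨g, g', hg, hg', ?_⟩
  rw [tendsto_nhds_unique hg'.norm hnorm]
  exact le_of_tendsto' hD hdρ

section Competitors

variable {n : ℕ} {σ : ℝ} {Ω : Set (Pt n)} {u₀ : Pt n → ℝ} {G₀ : Pt n → Pt n} {E₀ : Set (Pt n)}

/-- Admissible pairs with the same exterior data as `(u₀, E₀)`. -/
structure IsCompetitor (n : ℕ) (σ : ℝ) (Ω : Set (Pt n)) (u₀ : Pt n → ℝ) (E₀ : Set (Pt n))
    (u : Pt n → ℝ) (G : Pt n → Pt n) (E : Set (Pt n)) : Prop where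
  admissible : AdmissiblePair n σ Ω u G E
  ae_eq : ∀ᵐ x ∂(volume : Measure (Pt n)), x ∉ Ω → u x = u₀ x
  zeroExt : ZeroExtGradL2 n Ω (fun x => u x - u₀ x)
  symmDiff_eq : volume ((E \ Ω) ∆ (E₀ \ Ω)) = 0

lemma AdmissiblePair.memLp (h : AdmissiblePair n σ Ω u₀ G₀ E₀) :
    MemLp G₀ 2 (volume.restrict Ω) :=
  (memLp_two_iff_integrable_sq_norm (h.weakGrad.1.aestronglyMeasurable)).2 h.dirichletFin

lemma IsCompetitor.exists_zeroTraceGrad (hΩ : IsOpen Ω) (hΩb : IsBounded Ω)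
    (h₀ : AdmissiblePair n σ Ω u₀ G₀ E₀) {u : Pt n → ℝ} {G : Pt n → Pt n} {E : Set (Pt n)}
    (h : IsCompetitor n σ Ω u₀ E₀ u G E) :
    ∃ w H, ZeroTraceGrad n Ω w H ∧ (∀ᵐ x, u x = u₀ x + w x) ∧
      ∀ᵐ x, x ∈ Ω → G x = G₀ x + H x := by
  obtain ⟨H, hH, hsq⟩ := h.zeroExt
  have hsub : LocallyIntegrable (fun x => u x - u₀ x) volume := h.admissible.locInt.sub h₀.locInt
  have hw : Integrable (Ω.indicator fun x => u x - u₀ x) volume := by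
    rw [integrable_indicator_iff hΩ.measurableSet]
    exact (hsub.integrableOn_isCompact hΩb.isCompact_closure).mono_set subset_closure
  have hdec : ∀ᵐ x, u x = u₀ x + Ω.indicator (fun x => u x - u₀ x) x := by
    filter_upwards [h.ae_eq] with x hx
    by_cases hxΩ : x ∈ Ω
    · simp [hxΩ]
    · simp [hxΩ, hx hxΩ]
  refine ⟨_, H, ⟨hw, fun x hx => indicator_of_notMem hx _, hH, hsq⟩, hdec, ?_⟩
  have h1 := h₀.weakGrad.linearCombination h₀.locInt hw.locallyIntegrable
    (hH.mono (subset_univ Ω)) 1 1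
  have h2 := (h.admissible.weakGrad.congr (v := fun x =>
    1 * u₀ x + 1 * Ω.indicator (fun x => u x - u₀ x) x) (by
      filter_upwards [hdec] with x hx _
      simpa using hx)).ae_eq hΩ h1
  simpa using h2

lemma ZeroTraceGrad.isCompetitor (h₀ : AdmissiblePair n σ Ω u₀ G₀ E₀)
    {w : Pt n → ℝ} {H : Pt n → Pt n} (h : ZeroTraceGrad n Ω w H) {E : Set (Pt n)}
    (hE : MeasurableSet E) (hper : fracPer n σ E Ω ≠ ∞)
    (hpos : ∀ᵐ x ∂(volume : Measure (Pt n)), x ∈ E → 0 ≤ u₀ x + w x)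
    (hneg : ∀ᵐ x ∂(volume : Measure (Pt n)), x ∉ E → u₀ x + w x ≤ 0)
    (hEE₀ : volume ((E \ Ω) ∆ (E₀ \ Ω)) = 0) :
    IsCompetitor n σ Ω u₀ E₀ (fun x => u₀ x + w x) (fun x => G₀ x + H x) E where
  admissible :=
    { locInt := h₀.locInt.add h.integrable.locallyIntegrable
      weakGrad := by
        simpa using h₀.weakGrad.linearCombination h₀.locInt h.integrable.locallyIntegrable
          (h.weakGrad.mono (subset_univ Ω)) 1 1
      dirichletFin :=
        (h₀.memLp.add (h.memLp.restrict Ω)).integrable_norm_pow two_ne_zero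
      measE := hE
      perFin := hper
      nonnegOnE := hpos
      nonposOffE := hneg }
  ae_eq := Eventually.of_forall fun x hx => by simp [h.eq_zero x hx]
  zeroExt := by
    refine ⟨H, ?_, h.sq⟩
    convert h.weakGrad using 1
    ext x
    by_cases hx : x ∈ Ω
    · simp [hx]
    · simp [hx, h.eq_zero x hx]
  symmDiff_eq := hEE₀

lemma AdmissiblePair.isCompetitor (h₀ : AdmissiblePair n σ Ω u₀ G₀ E₀) :
    IsCompetitor n σ Ω u₀ E₀ u₀ G₀ E₀ where
  admissible := h₀
  ae_eq := Eventually.of_forall fun _ _ => rfl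
  zeroExt := by
    refine ⟨0, ⟨locallyIntegrableOn_zero, fun i φ _ _ _ => ?_⟩, by simp⟩
    simp
  symmDiff_eq := by simp

lemma IsCompetitor.trans (h₀ : AdmissiblePair n σ Ω u₀ G₀ E₀) (hΩ : IsOpen Ω)
    (hΩb : IsBounded Ω) {u v : Pt n → ℝ} {G K : Pt n → Pt n} {E F : Set (Pt n)}
    (h : IsCompetitor n σ Ω u₀ E₀ u G E) (hv : IsCompetitor n σ Ω u E v K F) :
    IsCompetitor n σ Ω u₀ E₀ v K F where
  admissible := hv.admissible
  ae_eq := by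
    filter_upwards [h.ae_eq, hv.ae_eq] with x hx hxv hxΩ
    rw [hxv hxΩ, hx hxΩ]
  zeroExt := by
    obtain ⟨w, H, hw, hwu, -⟩ := h.exists_zeroTraceGrad hΩ hΩb h₀
    obtain ⟨z, L, hz, hzv, -⟩ := hv.exists_zeroTraceGrad hΩ hΩb h.admissible
    have hwz := hw.linearCombination hz 1 1
    refine ⟨_, hwz.weakGrad.congr ?_, hwz.sq⟩
    filter_upwards [hwu, hzv] with x hx hxv _
    by_cases hxΩ : x ∈ Ω
    · simp [hxΩ, hx, hxv]
      ring
    · simp [hxΩ, hw.eq_zero x hxΩ, hz.eq_zero x hxΩ]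
  symmDiff_eq := by
    refine measure_mono_null (symmDiff_triangle _ (E \ Ω) _) ?_
    exact measure_union_null hv.symmDiff_eq h.symmDiff_eq

lemma Lp.norm_sq_eq_integral {μ : Measure (Pt n)} (g : Lp (Pt n) 2 μ) :
    ‖g‖ ^ 2 = ∫ x, ‖g x‖ ^ 2 ∂μ := by
  rw [← real_inner_self_eq_norm_sq, L2.inner_def]
  simp_rw [real_inner_self_eq_norm_sq]

/-- Competitors with convergent Dirichlet energies and convergent sets have a limit function
whose Dirichlet energy is at most the limit of the energies. -/
lemma exists_limit_of_isCompetitor (hn : 1 ≤ n) (hΩ : IsOpen Ω) (hΩb : IsBounded Ω)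
    (h₀ : AdmissiblePair n σ Ω u₀ G₀ E₀) {u : ℕ → Pt n → ℝ} {G : ℕ → Pt n → Pt n}
    {E : ℕ → Set (Pt n)} (h : ∀ k, IsCompetitor n σ Ω u₀ E₀ (u k) (G k) (E k)) {a : ℝ}
    (ha : Tendsto (fun k => ∫ x in Ω, ‖G k x‖ ^ 2) atTop (𝓝 a)) {E' : Set (Pt n)}
    (hE' : ∀ᵐ x, ∀ᶠ k in atTop, x ∈ E k ↔ x ∈ E') :
    ∃ w H, ZeroTraceGrad n Ω w H ∧ (∀ᵐ x, x ∈ E' → 0 ≤ u₀ x + w x) ∧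
      (∀ᵐ x, x ∉ E' → u₀ x + w x ≤ 0) ∧ ∫ x in Ω, ‖G₀ x + H x‖ ^ 2 ≤ a := by
  have ha0 : 0 ≤ a := ge_of_tendsto' ha fun k => integral_nonneg fun x => by positivity
  set S : ℕ → Set (Lp (Pt n) 2 (volume.restrict Ω)) := fun k => {g | ∃ w H,
    ZeroTraceGrad n Ω w H ∧ (g =ᵐ[volume.restrict Ω] fun x => G₀ x + H x) ∧
      (∀ᵐ x, (∀ j ≥ k, x ∈ E j) → 0 ≤ u₀ x + w x) ∧
      ∀ᵐ x, (∀ j ≥ k, x ∉ E j) → u₀ x + w x ≤ 0} with hSdef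
  have hanti : Antitone S := by
    rintro k l hkl g ⟨w, H, hw, hg, hp, hm⟩
    refine ⟨w, H, hw, hg, ?_, ?_⟩
    · filter_upwards [hp] with x hx hxE using hx fun j hj => hxE j (hkl.trans hj)
    · filter_upwards [hm] with x hx hxE using hx fun j hj => hxE j (hkl.trans hj)
  have hmid : ∀ k, ∀ x ∈ S k, ∀ y ∈ S k, (1 / 2 : ℝ) • x + (1 / 2 : ℝ) • y ∈ S k := by
    rintro k g₁ ⟨w₁, H₁, hw₁, hg₁, hp₁, hm₁⟩ g₂ ⟨w₂, H₂, hw₂, hg₂, hp₂, hm₂⟩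
    refine ⟨_, _, hw₁.linearCombination hw₂ (1 / 2) (1 / 2), ?_, ?_, ?_⟩
    · filter_upwards [Lp.coeFn_add ((1 / 2 : ℝ) • g₁) ((1 / 2 : ℝ) • g₂),
        Lp.coeFn_smul (1 / 2 : ℝ) g₁, Lp.coeFn_smul (1 / 2 : ℝ) g₂, hg₁, hg₂]
        with x h1 h2 h3 h4 h5
      rw [h1, Pi.add_apply, h2, h3, Pi.smul_apply, Pi.smul_apply, h4, h5]
      module
    · filter_upwards [hp₁, hp₂] with x h1 h2 hx
      linarith [h1 hx, h2 hx]
    · filter_upwards [hm₁, hm₂] with x h1 h2 hx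
      linarith [h1 hx, h2 hx]
  have hGm : ∀ k, MemLp (G k) 2 (volume.restrict Ω) := fun k => (h k).admissible.memLp
  have hmem : ∀ k, (hGm k).toLp ∈ S k := by
    intro k
    obtain ⟨w, H, hw, huw, hGH⟩ := (h k).exists_zeroTraceGrad hΩ hΩb h₀
    refine ⟨w, H, hw, ?_, ?_, ?_⟩
    · filter_upwards [(hGm k).coeFn_toLp, (ae_restrict_iff' hΩ.measurableSet).2 hGH] with x h1 h2
      rw [h1, h2]
    · filter_upwards [huw, (h k).admissible.nonnegOnE] with x h1 h2 hx
      rw [← h1]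
      exact h2 (hx k le_rfl)
    · filter_upwards [huw, (h k).admissible.nonposOffE] with x h1 h2 hx
      rw [← h1]
      exact h2 (hx k le_rfl)
  have hnorm : ∀ k, ‖(hGm k).toLp‖ = √(∫ x in Ω, ‖G k x‖ ^ 2) := by
    intro k
    rw [← Real.sqrt_sq (norm_nonneg (hGm k).toLp), Lp.norm_sq_eq_integral]
    congr 1
    refine integral_congr_ae ?_
    filter_upwards [(hGm k).coeFn_toLp] with x hx
    rw [hx]
  have hρ : Tendsto (fun k => ‖(hGm k).toLp‖) atTop (𝓝 √a) := by
    simp_rw [hnorm]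
    exact ha.sqrt
  obtain ⟨g, g', hgS, hgg', hg'⟩ := exists_tendsto_of_antitone_of_midpoint hanti hmid hmem hρ
  choose w H hw hgH hp hm using hgS
  have hK : MemLp (fun x => g' x - G₀ x) 2 (volume.restrict Ω) := (Lp.memLp g').sub h₀.memLp
  have hlim : Tendsto (fun k => eLpNorm (fun x => H k x - (g' x - G₀ x)) 2 (volume.restrict Ω))
      atTop (𝓝 0) := by
    refine ((Lp.tendsto_Lp_iff_tendsto_eLpNorm' g g').1 hgg').congr fun k => eLpNorm_congr_ae ?_
    filter_upwards [hgH k] with x hx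
    rw [Pi.sub_apply, hx]
    abel
  obtain ⟨w', hw', ns, hns, hae⟩ :=
    ZeroTraceGrad.exists_limit hn hΩb hΩ.measurableSet hw hK hlim
  refine ⟨w', _, hw', ?_, ?_, ?_⟩
  · filter_upwards [hae, hE', ae_all_iff.2 hp] with x hx hxE' hxp hxE
    obtain ⟨N, hN⟩ := eventually_atTop.1 hxE'
    refine ge_of_tendsto (hx.const_add (u₀ x)) ?_
    filter_upwards [hns.tendsto_atTop.eventually_ge_atTop N] with k hk
    exact hxp _ fun j hj => (hN j (hk.trans hj)).2 hxE
  · filter_upwards [hae, hE', ae_all_iff.2 hm] with x hx hxE' hxm hxE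
    obtain ⟨N, hN⟩ := eventually_atTop.1 hxE'
    refine le_of_tendsto (hx.const_add (u₀ x)) ?_
    filter_upwards [hns.tendsto_atTop.eventually_ge_atTop N] with k hk
    exact hxm _ fun j hj hxj => hxE ((hN j (hk.trans hj)).1 hxj)
  · calc ∫ x in Ω, ‖G₀ x + Ω.indicator (fun x => g' x - G₀ x) x‖ ^ 2 = ∫ x in Ω, ‖g' x‖ ^ 2 := by
          refine setIntegral_congr_fun hΩ.measurableSet fun x hx => ?_
          simp [hx]
      _ = ‖g'‖ ^ 2 := (Lp.norm_sq_eq_integral g').symm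
      _ ≤ √a ^ 2 := by gcongr
      _ = a := Real.sq_sqrt ha0

/-- The limit set of a sequence of sets whose perimeters `t k` converge together with `Φ (t k)`
has finite perimeter, and `Φ` of it is at most the limit. -/
lemma fracPer_limit_le (hΩ : MeasurableSet Ω) {Φ : ℝ → ℝ} (hmono : MonotoneOn Φ (Ici 0))
    (hlsc : LowerSemicontinuousOn Φ (Ici 0)) {E : ℕ → Set (Pt n)} {E' : Set (Pt n)}
    (hE : ∀ k, MeasurableSet (E k)) (hE' : MeasurableSet E')
    (hper : ∀ k, fracPer n σ (E k) Ω ≠ ∞)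
    (h : ∀ᵐ x, ∀ᶠ k in atTop, x ∈ E k ↔ x ∈ E') {s b : ℝ}
    (hs : Tendsto (fun k => (fracPer n σ (E k) Ω).toReal) atTop (𝓝 s))
    (hb : Tendsto (fun k => Φ (fracPer n σ (E k) Ω).toReal) atTop (𝓝 b)) :
    fracPer n σ E' Ω ≠ ∞ ∧ Φ (fracPer n σ E' Ω).toReal ≤ b := by
  have hs0 : 0 ≤ s := ge_of_tendsto' hs fun k => ENNReal.toReal_nonneg
  have hle : fracPer n σ E' Ω ≤ ENNReal.ofReal s := by
    refine (fracPer_le_liminf hΩ hE hE' h).trans_eq ?_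
    refine Tendsto.liminf_eq ((ENNReal.tendsto_ofReal hs).congr fun k => ?_)
    exact ENNReal.ofReal_toReal (hper k)
  refine ⟨ne_top_of_le_ne_top ENNReal.ofReal_ne_top hle, ?_⟩
  refine (hmono ENNReal.toReal_nonneg hs0 (ENNReal.toReal_le_of_le_ofReal hs0 hle)).trans ?_
  refine le_of_forall_lt fun y hy => ?_
  obtain ⟨z, hyz, hz⟩ := exists_between hy
  refine hyz.trans_le (ge_of_tendsto hb ?_)
  have hs' : Tendsto (fun k => (fracPer n σ (E k) Ω).toReal) atTop (𝓝[Ici 0] s) :=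
    tendsto_nhdsWithin_iff.2 ⟨hs, Eventually.of_forall fun k => ENNReal.toReal_nonneg⟩
  filter_upwards [hs'.eventually (hlsc s hs0 z hz)] with k hk using hk.le

end Competitors

/-- existence of minimal pairs (Lemma 2.3). -/
theorem statement8 (n : ℕ) (hn : 1 ≤ n) (σ : ℝ) (hσ : σ ∈ Set.Ioo (0 : ℝ) 1)
    (Ω : Set (Pt n)) (hΩo : IsOpen Ω) (hΩb : IsBounded Ω)
    (Φ : ℝ → ℝ)
    (hmono : MonotoneOn Φ (Set.Ici 0))
    (hlsc : LowerSemicontinuousOn Φ (Set.Ici 0))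
    (hnonneg : ∀ t : ℝ, 0 ≤ t → 0 ≤ Φ t)
    (hcoe : Tendsto Φ atTop atTop)
    (u₀ : Pt n → ℝ) (G₀ : Pt n → Pt n) (E₀ : Set (Pt n))
    (hadm : AdmissiblePair n σ Ω u₀ G₀ E₀) :
    ∃ (u : Pt n → ℝ) (E : Set (Pt n)),
      IsMinimalPair n σ Φ Ω u E ∧
      (∀ᵐ x ∂(volume : Measure (Pt n)), x ∉ Ω → u x = u₀ x) ∧
      ZeroExtGradL2 n Ω (fun x => u x - u₀ x) ∧
      volume ((E \ Ω) ∆ (E₀ \ Ω)) = 0 := by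
  set 𝓔 : Set ℝ := {e | ∃ u G E, IsCompetitor n σ Ω u₀ E₀ u G E ∧ e = energyF n σ Φ Ω G E}
    with h𝓔
  have hΦper : ∀ E : Set (Pt n), 0 ≤ Φ (fracPer n σ E Ω).toReal := fun E =>
    hnonneg _ ENNReal.toReal_nonneg
  have hdir : ∀ G : Pt n → Pt n, 0 ≤ ∫ x in Ω, ‖G x‖ ^ 2 := fun G =>
    integral_nonneg fun x => by positivity
  have hbdd : BddBelow 𝓔 := by
    refine ⟨0, ?_⟩
    rintro _ ⟨u, G, E, -, rfl⟩
    exact add_nonneg (hdir G) (hΦper E)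
  have hne : 𝓔.Nonempty := ⟨_, u₀, G₀, E₀, hadm.isCompetitor, rfl⟩
  obtain ⟨e, heanti, helim, hemem⟩ := exists_seq_tendsto_sInf hne hbdd
  choose u G E hcomp heq using hemem
  obtain ⟨T, hT⟩ := (tendsto_atTop.1 hcoe (e 0 + 1)).exists_forall_of_atTop
  have hdirle : ∀ k, ∫ x in Ω, ‖G k x‖ ^ 2 ≤ e 0 := fun k => by
    have h1 := heanti (Nat.zero_le k)
    have h2 := heq k
    have h3 := hΦper (E k)
    rw [energyF] at h2
    linarith
  have hperle : ∀ k, (fracPer n σ (E k) Ω).toReal ≤ T := fun k => by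
    by_contra! hlt
    have h1 := heanti (Nat.zero_le k)
    have h2 := heq k
    have h3 := hdir (G k)
    have h4 := hT _ hlt.le
    rw [energyF] at h2
    linarith
  obtain ⟨⟨a, s⟩, -, φ, hφ, hφlim⟩ :=
    (isCompact_Icc.prod isCompact_Icc).tendsto_subseq (x := fun k =>
      ((∫ x in Ω, ‖G k x‖ ^ 2), (fracPer n σ (E k) Ω).toReal))
      (fun k => mk_mem_prod ⟨hdir (G k), hdirle k⟩ ⟨ENNReal.toReal_nonneg, hperle k⟩)
  obtain ⟨ψ, hψ, E', hE'm, hE'⟩ := exists_subseq_ae_eventually_mem_iff (E := fun k => E (φ k))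
    hσ.1 hΩo.measurableSet hΩb.measure_lt_top.ne (fun k => (hcomp (φ k)).admissible.measE)
    (C := ENNReal.ofReal T) ENNReal.ofReal_ne_top
    (fun k => ENNReal.le_ofReal_iff_toReal_le (hcomp (φ k)).admissible.perFin
      (ENNReal.toReal_nonneg.trans (hperle 0)) |>.2 (hperle (φ k)))
    (fun k => (hcomp (φ k)).symmDiff_eq)
  have ha : Tendsto (fun k => ∫ x in Ω, ‖G (φ (ψ k)) x‖ ^ 2) atTop (𝓝 a) :=
    ((continuous_fst.tendsto _).comp hφlim).comp hψ.tendsto_atTop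
  have hs : Tendsto (fun k => (fracPer n σ (E (φ (ψ k))) Ω).toReal) atTop (𝓝 s) :=
    ((continuous_snd.tendsto _).comp hφlim).comp hψ.tendsto_atTop
  have hb : Tendsto (fun k => Φ (fracPer n σ (E (φ (ψ k))) Ω).toReal) atTop (𝓝 (sInf 𝓔 - a)) := by
    refine ((helim.comp (hφ.comp hψ).tendsto_atTop).sub ha).congr fun k => ?_
    simp only [Function.comp_apply, heq, energyF]
    ring
  obtain ⟨hper, hΦle⟩ := fracPer_limit_le hΩo.measurableSet hmono hlsc
    (fun k => (hcomp (φ (ψ k))).admissible.measE) hE'm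
    (fun k => (hcomp (φ (ψ k))).admissible.perFin) hE' hs hb
  obtain ⟨w, H, hw, hpos, hneg, hle⟩ := exists_limit_of_isCompetitor hn hΩo hΩb hadm
    (fun k => hcomp (φ (ψ k))) ha hE'
  have hout : volume ((E' \ Ω) ∆ (E₀ \ Ω)) = 0 := by
    rw [measure_symmDiff_eq_zero_iff]
    filter_upwards [hE', ae_all_iff.2 fun k => measure_symmDiff_eq_zero_iff.1
      (hcomp (φ (ψ k))).symmDiff_eq] with x hx hx'
    obtain ⟨k, hk⟩ := hx.exists
    have hk' : x ∈ E (φ (ψ k)) \ Ω ↔ x ∈ E₀ \ Ω := iff_of_eq (hx' k)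
    refine propext (Iff.trans ?_ hk')
    exact and_congr_left fun _ => hk.symm
  have hmin := hw.isCompetitor hadm hE'm hper hpos hneg hout
  refine ⟨_, E', ⟨_, hmin.admissible, fun v K F hv hve hvz hvF => ?_⟩, hmin.ae_eq, hmin.zeroExt,
    hmin.symmDiff_eq⟩
  have hcompv := hmin.trans hadm hΩo hΩb ⟨hv, hve, hvz, hvF⟩
  refine le_trans ?_ (csInf_le hbdd ⟨v, K, F, hcompv, rfl⟩)
  rw [energyF]
  linarith
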